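/- arXiv:1910.07281 — 6 statements merged into one kernel-verified Lean document; each statement's English description precedes it below -/
import Mathlib

section
/- If G is a radially maximal graph with radius r and diameter d, then r ≤ d ≤ 2r - 2. -/
open SimpleGraph

/-- The eccentricity of a vertex `v`: the maximum distance from `v` to any vertex. -/
noncomputable def eccentricity {V : Type*} [Fintype V] (G : SimpleGraph V) (v : V) : ℕ :=
  Finset.univ.sup fun u => G.dist v u

/-- The radius of a graph: the minimum eccentricity over all vertices. -/
noncomputable def graphRadius {V : Type*} [Fintype V] (G : SimpleGraph V) : ℕ :=
  ⨅ v, eccentricity G v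

/-- The diameter of a graph: the maximum eccentricity over all vertices. -/
noncomputable def graphDiam {V : Type*} [Fintype V] (G : SimpleGraph V) : ℕ :=
  Finset.univ.sup fun v => eccentricity G v

/-- A connected graph is radially maximal if it is not complete and adding
any edge of the complement strictly decreases the radius. -/
def RadiallyMaximal {V : Type*} [Fintype V] (G : SimpleGraph V) : Prop :=
  G.Connected ∧ G ≠ ⊤ ∧ ∀ u v : V, u ≠ v → ¬ G.Adj u v →
    graphRadius (G ⊔ SimpleGraph.edge u v) < graphRadius G


theorem walk_cyc {V : Type*} (G : SimpleGraph V) (hc : G.Connected) (a b : V)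
    (hd : ∀ v, G.dist a v ≤ G.dist a b) {u v : V} (p : (G ⊔ SimpleGraph.edge a b).Walk u v) :
    (G.dist a u ≤ G.dist a v + p.length ∧ G.dist a v ≤ G.dist a u + p.length) ∨
    G.dist a b + 1 + G.dist a u ≤ p.length + G.dist a v ∨
    G.dist a b + 1 + G.dist a v ≤ p.length + G.dist a u := by
  induction p with
  | nil => left; simp
  | @cons x y z h p ih =>
    have hx := hd x
    have hy := hd y
    have hz := hd z
    rw [Walk.length_cons]
    rw [SimpleGraph.sup_adj, SimpleGraph.edge_adj] at h
    rcases h with h | ⟨⟨rfl, rfl⟩ | ⟨rfl, rfl⟩, hne⟩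
    · have h1 := hc.dist_triangle (u := a) (v := x) (w := y)
      have h2 := hc.dist_triangle (u := a) (v := y) (w := x)
      have h3 := SimpleGraph.dist_eq_one_iff_adj.2 h
      have h4 := SimpleGraph.dist_eq_one_iff_adj.2 h.symm
      omega
    · have : G.dist x x = 0 := SimpleGraph.dist_self
      omega
    · have : G.dist y y = 0 := SimpleGraph.dist_self
      omega

theorem level_exists {V : Type*} (G : SimpleGraph V) (hc : G.Connected) (a b : V) (t : ℕ)
    (ht : t ≤ G.dist a b) : ∃ x, G.dist a x = t := by
  obtain ⟨p, hp⟩ := hc.exists_walk_length_eq_dist a b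
  refine ⟨p.getVert t, ?_⟩
  have h1 := SimpleGraph.dist_le (p.take t)
  have h2 := SimpleGraph.dist_le (p.drop t)
  have h3 := hc.dist_triangle (u := a) (v := p.getVert t) (w := b)
  rw [Walk.take_length] at h1
  rw [Walk.drop_length] at h2
  omega

/-- If `G` is a radially maximal graph with radius `r` and diameter `d`,
then `r ≤ d ≤ 2r - 2`. -/
theorem stmt_0 {V : Type*} [Fintype V] (G : SimpleGraph V)
    (hG : RadiallyMaximal G) :
    graphRadius G ≤ graphDiam G ∧ graphDiam G + 2 ≤ 2 * graphRadius G := by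
  obtain ⟨hc, hne, hmax⟩ := hG
  haveI := hc.nonempty
  have hle : ∀ u v, G.dist u v ≤ graphDiam G := fun u v =>
    (Finset.le_sup (f := fun w => G.dist u w) (Finset.mem_univ v)).trans
      (Finset.le_sup (f := fun w => eccentricity G w) (Finset.mem_univ u))
  refine ⟨?_, ?_⟩
  · obtain ⟨v⟩ := hc.nonempty
    exact (ciInf_le (OrderBot.bddBelow _) v).trans
      (Finset.le_sup (f := fun w => eccentricity G w) (Finset.mem_univ v))
  · by_contra hlt
    obtain ⟨a, -, ha⟩ := Finset.exists_mem_eq_sup Finset.univ Finset.univ_nonempty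
      (fun w => eccentricity G w)
    obtain ⟨b, -, hb⟩ := Finset.exists_mem_eq_sup Finset.univ Finset.univ_nonempty
      (fun w => G.dist a w)
    have hab : graphDiam G = G.dist a b := ha.trans hb
    have h2 : 2 ≤ G.dist a b := by
      by_contra h
      apply hne
      ext u v
      rw [SimpleGraph.top_adj]
      refine ⟨fun h => h.ne, fun huv => ?_⟩
      have h1 := hle u v
      have h3 := hc.pos_dist_of_ne huv
      exact SimpleGraph.dist_eq_one_iff_adj.1 (by omega)
    have hanb : a ≠ b := by
      rintro rfl
      simp at h2
    have hnadj : ¬ G.Adj a b := fun h => by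
      have := SimpleGraph.dist_eq_one_iff_adj.2 h
      omega
    have hd : ∀ v, G.dist a v ≤ G.dist a b := fun v => hab ▸ hle a v
    have hc' : (G ⊔ SimpleGraph.edge a b).Connected := hc.mono le_sup_left
    have := hmax a b hanb hnadj
    refine absurd this (not_lt.2 ?_)
    refine le_ciInf fun v => ?_
    have hv := hd v
    have key : ∀ x, (G.dist a x = G.dist a v + graphRadius G ∨
        G.dist a x + graphRadius G = G.dist a v) →
        graphRadius G ≤ eccentricity (G ⊔ SimpleGraph.edge a b) v := by
      intro x hx
      refine le_trans ?_ (Finset.le_sup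
        (f := fun w => (G ⊔ SimpleGraph.edge a b).dist v w) (Finset.mem_univ x))
      obtain ⟨p, hp⟩ := hc'.exists_walk_length_eq_dist v x
      have := walk_cyc G hc a b hd p
      have := hd x
      show _ ≤ (G ⊔ SimpleGraph.edge a b).dist v x
      omega
    by_cases hr : G.dist a v + graphRadius G ≤ G.dist a b
    · obtain ⟨x, hx⟩ := level_exists G hc a b _ hr
      exact key x (Or.inl hx)
    · obtain ⟨x, hx⟩ := level_exists G hc a b (G.dist a v - graphRadius G) (by omega)
      exact key x (Or.inr (by omega))
end

section
/- For all positive integers r and n with r ≥ 2 and n ≥ 2r, there exists a self-centered radially maximal graph of radius r and order n. -/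
open SimpleGraph

/-- position on the cycle -/
def pos (r x : ℕ) : ℕ := min x (2 * r - 1)

/-- cyclic distance on the cycle of length `2r` -/
def cyc (r a b : ℕ) : ℕ := min (max a b - min a b) (2 * r - (max a b - min a b))

/-- distance between vertices, up to twins -/
def cd (r x y : ℕ) : ℕ := cyc r (pos r x) (pos r y)

lemma cd_comm (r x y : ℕ) : cd r x y = cd r y x := by
  unfold cd cyc; rw [max_comm, min_comm (pos r x)]

/-- The cycle of length `2r` with one vertex blown up to a clique. -/
def blow (r n : ℕ) : SimpleGraph (Fin n) where
  Adj x y := x ≠ y ∧ cd r x y ≤ 1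
  symm := ⟨fun x y h => ⟨h.1.symm, by rw [cd_comm]; exact h.2⟩⟩
  loopless := ⟨fun x h => h.1 rfl⟩

lemma blow_adj {r n : ℕ} {x y : Fin n} (h : x ≠ y) (h1 : cd r x y ≤ 1) :
    (blow r n).Adj x y := ⟨h, h1⟩

lemma cd_le (r x y : ℕ) : cd r x y ≤ r := by
  unfold cd cyc pos; omega

lemma cd_tri (r x y z : ℕ) (hr : 2 ≤ r) (h : cd r x y ≤ 1) : cd r x z ≤ cd r y z + 1 := by
  unfold cd cyc pos at *; omega

lemma cd_step (r x y : ℕ) (hr : 2 ≤ r) (h : 2 ≤ cd r x y) :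
    ∃ z, z < 2 * r ∧ z ≠ x ∧ cd r x z ≤ 1 ∧ cd r z y + 1 = cd r x y := by
  have hx : pos r x < 2 * r := by unfold pos; omega
  have hy : pos r y < 2 * r := by unfold pos; omega
  have key : ∀ z, z < 2 * r → cyc r (pos r x) z ≤ 1 →
      cyc r z (pos r y) + 1 = cyc r (pos r x) (pos r y) →
      ∃ z, z < 2 * r ∧ z ≠ x ∧ cd r x z ≤ 1 ∧ cd r z y + 1 = cd r x y := by
    intro z hz h1 h2
    have hp : pos r z = z := by unfold pos; omega
    refine ⟨z, hz, ?_, ?_, ?_⟩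
    · rintro rfl
      rw [hp] at h2; omega
    · unfold cd; rw [hp]; exact h1
    · unfold cd; rw [hp]; exact h2
  unfold cd at h
  generalize pos r x = a at *
  generalize pos r y = b at *
  by_cases hfwd : (a < b ∧ b - a ≤ r) ∨ (b < a ∧ r ≤ a - b)
  · by_cases ha : a + 1 = 2 * r
    · exact key 0 (by omega) (by unfold cyc at *; omega) (by unfold cyc at *; omega)
    · exact key (a + 1) (by omega) (by unfold cyc at *; omega) (by unfold cyc at *; omega)
  · by_cases ha : a = 0
    · exact key (2 * r - 1) (by omega) (by unfold cyc at *; omega) (by unfold cyc at *; omega)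
    · exact key (a - 1) (by omega) (by unfold cyc at *; omega) (by unfold cyc at *; omega)

lemma cd_far (r x : ℕ) (hr : 2 ≤ r) : ∃ z, z < 2 * r ∧ cd r x z = r := by
  by_cases h : pos r x < r
  · exact ⟨pos r x + r, by omega, by unfold cd cyc pos at *; omega⟩
  · exact ⟨pos r x - r, by unfold pos; omega, by unfold cd cyc pos at *; omega⟩

lemma cd_anti (r u v w : ℕ) (hr : 2 ≤ r) (h : cd r u w = r) :
    cd r v w + cd r u v = r := by
  unfold cd cyc pos at *; omega

lemma walk_lower {r n : ℕ} (hr : 2 ≤ r) {x y : Fin n} (p : (blow r n).Walk x y) :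
    cd r x y ≤ p.length := by
  induction p with
  | nil => unfold cd cyc; simp
  | cons h p ih =>
    rw [Walk.length_cons]
    exact (cd_tri r _ _ _ hr h.2).trans (by omega)

lemma walk_upper {r n : ℕ} (hr : 2 ≤ r) (hn : 2 * r ≤ n) (k : ℕ) :
    ∀ x y : Fin n, cd r x y ≤ k → ∃ p : (blow r n).Walk x y, p.length ≤ max 1 k := by
  induction k with
  | zero =>
    intro x y h
    by_cases hxy : x = y
    · subst hxy; exact ⟨Walk.nil, by simp⟩
    · exact ⟨Walk.cons (blow_adj hxy (by omega)) Walk.nil, by simp⟩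
  | succ k ih =>
    intro x y h
    by_cases h2 : 2 ≤ cd r x y
    · obtain ⟨z, hz, hzx, h1, h3⟩ := cd_step r x y hr h2
      obtain ⟨p, hp⟩ := ih ⟨z, by omega⟩ y (by simp only; omega)
      refine ⟨Walk.cons (blow_adj (fun e => hzx (by rw [e])) h1) p, ?_⟩
      rw [Walk.length_cons]; omega
    · by_cases hxy : x = y
      · subst hxy; exact ⟨Walk.nil, by simp⟩
      · exact ⟨Walk.cons (blow_adj hxy (by omega)) Walk.nil, by simp⟩

lemma blow_conn {r n : ℕ} (hr : 2 ≤ r) (hn : 2 * r ≤ n) : (blow r n).Connected := by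
  have : Nonempty (Fin n) := ⟨⟨0, by omega⟩⟩
  exact ⟨fun x y => ⟨(walk_upper hr hn _ x y le_rfl).choose⟩⟩

lemma blow_ecc {r n : ℕ} (hr : 2 ≤ r) (hn : 2 * r ≤ n) (x : Fin n) :
    eccentricity (blow r n) x = r := by
  unfold eccentricity
  apply le_antisymm
  · refine Finset.sup_le fun y _ => ?_
    obtain ⟨p, hp⟩ := walk_upper hr hn r x y (cd_le _ _ _)
    exact (dist_le p).trans (by omega)
  · obtain ⟨z, hz, h⟩ := cd_far r x hr
    refine le_trans ?_ (Finset.le_sup (Finset.mem_univ (⟨z, by omega⟩ : Fin n)))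
    obtain ⟨p, hp⟩ := (blow_conn hr hn).exists_walk_length_eq_dist x ⟨z, by omega⟩
    have := walk_lower hr p
    simp only at this
    omega

lemma blow_add {r n : ℕ} (hr : 2 ≤ r) (hn : 2 * r ≤ n) (u v : Fin n) (huv : u ≠ v)
    (hadj : ¬ (blow r n).Adj u v) (hc : 2 * r - 1 ≤ u.val ∨ v.val < 2 * r - 1) :
    graphRadius (blow r n ⊔ SimpleGraph.edge u v) < r := by
  have hd : 2 ≤ cd r u v := by
    by_contra h
    exact hadj ⟨huv, by omega⟩
  have hA : (blow r n ⊔ SimpleGraph.edge u v).Adj u v := by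
    right; simp [SimpleGraph.edge_adj, huv]
  have hle : blow r n ≤ blow r n ⊔ SimpleGraph.edge u v := le_sup_left
  refine lt_of_le_of_lt (ciInf_le (OrderBot.bddBelow _) u) ?_
  suffices h : eccentricity (blow r n ⊔ SimpleGraph.edge u v) u ≤ r - 1 by omega
  refine Finset.sup_le fun w _ => ?_
  by_cases hw : cd r u w = r
  · have h1 := cd_anti r u v w hr hw
    by_cases h0 : cd r v w = 0
    · have : v = w := by
        apply Fin.ext
        unfold cd cyc pos at *; omega
      subst this
      exact (dist_le (Walk.cons hA Walk.nil)).trans (by simp; omega)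
    · obtain ⟨p, hp⟩ := walk_upper hr hn _ v w le_rfl
      refine (dist_le (Walk.cons hA (p.mapLe hle))).trans ?_
      simp only [Walk.length_cons, Walk.length_map, Walk.mapLe]
      omega
  · have := cd_le r u w
    obtain ⟨p, hp⟩ := walk_upper hr hn _ u w le_rfl
    refine (dist_le (p.mapLe hle)).trans ?_
    simp only [Walk.length_map, Walk.mapLe]
    omega

/-- For all positive integers `r`, `n` with `r ≥ 2` and `n ≥ 2r`, there is a
self-centered radially maximal graph of radius `r` and order `n`. -/
theorem stmt_1 (r n : ℕ) (hr : 2 ≤ r) (hn : 2 * r ≤ n) :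
    ∃ G : SimpleGraph (Fin n), RadiallyMaximal G ∧
      graphRadius G = graphDiam G ∧ graphRadius G = r := by
  have : Nonempty (Fin n) := ⟨⟨0, by omega⟩⟩
  have hrad : graphRadius (blow r n) = r := by
    unfold graphRadius; simp [blow_ecc hr hn]
  have hdiam : graphDiam (blow r n) = r := by
    unfold graphDiam; simp only [blow_ecc hr hn]
    exact Finset.sup_const Finset.univ_nonempty r
  refine ⟨blow r n, ⟨blow_conn hr hn, ?_, ?_⟩, by rw [hrad, hdiam], hrad⟩
  · intro h
    obtain ⟨z, hz, h2⟩ := cd_far r 0 hr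
    have hne : (⟨0, by omega⟩ : Fin n) ≠ ⟨z, by omega⟩ := by
      intro e
      have : 0 = z := congrArg Fin.val e
      subst this
      unfold cd cyc at h2; omega
    have ha : (blow r n).Adj ⟨0, by omega⟩ ⟨z, by omega⟩ := by
      rw [h]; exact hne
    have := ha.2
    simp only at this
    omega
  · intro u v huv hadj
    rw [hrad]
    by_cases hc : 2 * r - 1 ≤ u.val ∨ v.val < 2 * r - 1
    · exact blow_add hr hn u v huv hadj hc
    · rw [SimpleGraph.edge_comm]
      exact blow_add hr hn v u huv.symm (fun h => hadj h.symm) (by omega)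
end

section
/- For positive integers r and d, there exists a radially maximal graph of radius r and diameter d if and only if r ≤ d ≤ 2r - 2. -/
open SimpleGraph

namespace RM

section gen
variable {V : Type*} [Fintype V]

lemma radius_le {G : SimpleGraph V} {k : ℕ} (v : V) (h : ∀ u, G.dist v u ≤ k) :
    graphRadius G ≤ k :=
  (ciInf_le' _ v).trans (Finset.sup_le fun u _ => h u)

lemma le_radius {G : SimpleGraph V} [Nonempty V] {k : ℕ} (h : ∀ v, ∃ u, k ≤ G.dist v u) :
    k ≤ graphRadius G := by
  refine le_ciInf fun v => ?_
  obtain ⟨u, hu⟩ := h v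
  exact hu.trans (Finset.le_sup (f := fun u => G.dist v u) (Finset.mem_univ u))

lemma diam_le {G : SimpleGraph V} {k : ℕ} (h : ∀ v u, G.dist v u ≤ k) :
    graphDiam G ≤ k :=
  Finset.sup_le fun v _ => Finset.sup_le fun u _ => h v u

lemma dist_le_diam (G : SimpleGraph V) (u v : V) : G.dist u v ≤ graphDiam G :=
  (Finset.le_sup (f := fun u' => G.dist u u') (Finset.mem_univ v)).trans
    (Finset.le_sup (f := fun u' => eccentricity G u') (Finset.mem_univ u))

lemma exists_diam (G : SimpleGraph V) [Nonempty V] : ∃ u v, G.dist u v = graphDiam G := by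
  obtain ⟨u, -, hu⟩ := Finset.exists_mem_eq_sup (Finset.univ : Finset V) Finset.univ_nonempty
    (fun v => eccentricity G v)
  obtain ⟨v, -, hv⟩ := Finset.exists_mem_eq_sup (Finset.univ : Finset V) Finset.univ_nonempty
    (fun v => G.dist u v)
  exact ⟨u, v, (hu.trans hv).symm⟩

lemma radius_le_diam (G : SimpleGraph V) [Nonempty V] : graphRadius G ≤ graphDiam G :=
  radius_le (Classical.arbitrary V) fun u => dist_le_diam G _ u

end gen

lemma lip {V : Type*} {G : SimpleGraph V} (hG : G.Connected) (f : V → ℕ)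
    (hf : ∀ u v, G.Adj u v → f v ≤ f u + 1) (u v : V) : f v ≤ f u + G.dist u v := by
  obtain ⟨p, hp⟩ := hG.exists_walk_length_eq_dist u v
  rw [← hp]
  clear hp
  induction p with
  | nil => simp
  | cons h p ih =>
    have := hf _ _ h
    simp only [SimpleGraph.Walk.length_cons]
    omega

lemma descend {V : Type*} {G : SimpleGraph V} (u : V) (P : V → Prop) (D : V → ℕ)
    (h : ∀ w, P w → w = u ∨ ∃ w', P w' ∧ G.Adj w' w ∧ D w' < D w) :
    ∀ n w, P w → D w ≤ n → G.Reachable u w ∧ G.dist u w ≤ D w := by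
  intro n
  induction n with
  | zero =>
    intro w hw hD
    rcases h w hw with rfl | ⟨w', _, _, h3⟩
    · exact ⟨SimpleGraph.Reachable.refl _, by simp⟩
    · omega
  | succ n ih =>
    intro w hw hD
    rcases h w hw with rfl | ⟨w', h1, h2, h3⟩
    · exact ⟨SimpleGraph.Reachable.refl _, by simp⟩
    · obtain ⟨a, b⟩ := ih w' h1 (by omega)
      have h4 : G.dist w' w = 1 := SimpleGraph.dist_eq_one_iff_adj.2 h2
      have h5 := a.dist_triangle_left w
      exact ⟨a.trans h2.reachable, by omega⟩

lemma exists_dist {V : Type*} {G : SimpleGraph V} (hG : G.Connected) (x y : V) (k : ℕ)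
    (hk : k ≤ G.dist x y) : ∃ w, G.dist x w = k := by
  obtain ⟨p, hp⟩ := hG.exists_walk_length_eq_dist x y
  refine ⟨p.getVert k, ?_⟩
  have h1 := G.dist_le (p.take k)
  have h2 := G.dist_le (p.drop k)
  have h3 := hG.dist_triangle (u := x) (v := p.getVert k) (w := y)
  have h4 : (p.take k).length = k := by simp; omega
  have h5 : (p.drop k).length = p.length - k := by simp
  omega

lemma sup_edge_connected {V : Type*} {G : SimpleGraph V} (hG : G.Connected) (u v : V) :
    (G ⊔ SimpleGraph.edge u v).Connected := hG.mono le_sup_left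

lemma sup_edge_dist {V : Type*} {G : SimpleGraph V} (hG : G.Connected) (u v a b : V) :
    (G ⊔ SimpleGraph.edge u v).dist a b ≤ G.dist a b :=
  SimpleGraph.Reachable.dist_anti le_sup_left (hG.preconnected a b)

lemma sup_edge_dist' {V : Type*} {G : SimpleGraph V} (hG : G.Connected) (u v a b : V)
    (huv : u ≠ v) :
    (G ⊔ SimpleGraph.edge u v).dist a b ≤ G.dist a u + 1 + G.dist v b := by
  have hc := sup_edge_connected hG u v
  have h1 := sup_edge_dist hG u v a u
  have h2 := sup_edge_dist hG u v v b
  have h3 : (G ⊔ SimpleGraph.edge u v).dist u v = 1 := by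
    rw [SimpleGraph.dist_eq_one_iff_adj, SimpleGraph.sup_adj, SimpleGraph.edge_adj]
    exact Or.inr ⟨Or.inl ⟨rfl, rfl⟩, huv⟩
  have h4 := hc.dist_triangle (u := a) (v := u) (w := b)
  have h5 := hc.dist_triangle (u := u) (v := v) (w := b)
  omega

def cyc (N a b : ℕ) : ℕ := min (a - b + (b - a)) (N - (a - b + (b - a)))

lemma forward {n : ℕ} (G : SimpleGraph (Fin n)) (hG : RadiallyMaximal G) :
    graphRadius G ≤ graphDiam G ∧ graphDiam G + 2 ≤ 2 * graphRadius G := by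
  obtain ⟨hc, hne, hmax⟩ := hG
  have := hc.nonempty
  refine ⟨radius_le_diam G, ?_⟩
  by_contra hcon
  obtain ⟨x, y, hxy⟩ := exists_diam G
  have hd2 : 2 ≤ graphDiam G := by
    by_contra hlt
    apply hne
    ext a b
    simp only [SimpleGraph.top_adj]
    refine ⟨fun h => h.ne, fun h => ?_⟩
    by_contra hab
    have h1 := hc.one_lt_dist_of_ne_of_not_adj h hab
    have h2 := dist_le_diam G a b
    omega
  have hxne : x ≠ y := by
    rintro rfl
    simp at hxy
    omega
  have hnadj : ¬ G.Adj x y := by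
    intro h
    have := SimpleGraph.dist_eq_one_iff_adj.2 h
    omega
  have hlt := hmax x y hxne hnadj
  set r := graphRadius G
  set d := graphDiam G
  refine absurd hlt (not_lt.2 (le_radius fun v => ?_))
  have hvd := dist_le_diam G x v
  obtain ⟨w, hw⟩ : ∃ w, G.dist x w = G.dist x v + r ∨ G.dist x w + r = G.dist x v := by
    by_cases h : r ≤ G.dist x v
    · obtain ⟨w, hw⟩ := exists_dist hc x y (G.dist x v - r) (by omega)
      exact ⟨w, Or.inr (by omega)⟩
    · obtain ⟨w, hw⟩ := exists_dist hc x y (G.dist x v + r) (by omega)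
      exact ⟨w, Or.inl (by omega)⟩
  refine ⟨w, ?_⟩
  have hwd := dist_le_diam G x w
  have := lip (sup_edge_connected hc x y) (fun u => cyc (d + 1) (G.dist x v) (G.dist x u)) ?_ v w
  · simp only [cyc] at this
    omega
  · intro a b hab
    have ha := dist_le_diam G x a
    have hb := dist_le_diam G x b
    rw [SimpleGraph.sup_adj, SimpleGraph.edge_adj] at hab
    simp only [cyc]
    rcases hab with hab | ⟨⟨rfl, rfl⟩ | ⟨rfl, rfl⟩, _⟩
    · have h1 := SimpleGraph.dist_eq_one_iff_adj.2 hab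
      have h2 := SimpleGraph.dist_eq_one_iff_adj.2 hab.symm
      have h3 := hc.dist_triangle (u := x) (v := a) (w := b)
      have h4 := hc.dist_triangle (u := x) (v := b) (w := a)
      omega
    · have : G.dist a a = 0 := by simp
      omega
    · have : G.dist b b = 0 := by simp
      omega

section transfer
variable {V W : Type*} [Fintype V] [Fintype W]

lemma iso_dist {G : SimpleGraph V} {H : SimpleGraph W} (e : G ≃g H) (hG : G.Connected)
    (u v : V) : H.dist (e u) (e v) = G.dist u v := by
  have hH : H.Connected := (e.connected_iff).1 hG
  apply le_antisymm
  · obtain ⟨p, hp⟩ := hG.exists_walk_length_eq_dist u v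
    have := H.dist_le (p.map e.toHom)
    rw [SimpleGraph.Walk.length_map] at this
    exact this.trans hp.le
  · obtain ⟨p, hp⟩ := hH.exists_walk_length_eq_dist (e u) (e v)
    have := G.dist_le (p.map e.symm.toHom)
    rw [SimpleGraph.Walk.length_map, hp] at this
    have hu : e.symm.toHom (e u) = u := e.symm_apply_apply u
    have hv : e.symm.toHom (e v) = v := e.symm_apply_apply v
    rwa [hu, hv] at this

lemma iso_radius {G : SimpleGraph V} {H : SimpleGraph W} (e : G ≃g H) (hG : G.Connected) :
    graphRadius H ≤ graphRadius G := by
  have := hG.nonempty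
  refine le_ciInf fun v => radius_le (e v) fun u => ?_
  obtain ⟨u, rfl⟩ := e.surjective u
  rw [iso_dist e hG]
  exact Finset.le_sup (f := fun u => G.dist v u) (Finset.mem_univ u)

lemma iso_diam {G : SimpleGraph V} {H : SimpleGraph W} (e : G ≃g H) (hG : G.Connected) :
    graphDiam H ≤ graphDiam G := by
  refine diam_le fun v u => ?_
  obtain ⟨u, rfl⟩ := e.surjective u
  obtain ⟨v, rfl⟩ := e.surjective v
  rw [iso_dist e hG]
  exact dist_le_diam _ _ _

lemma transfer (G : SimpleGraph V) (hG : RadiallyMaximal G) :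
    ∃ (n : ℕ) (H : SimpleGraph (Fin n)), RadiallyMaximal H ∧
        graphRadius H = graphRadius G ∧ graphDiam H = graphDiam G := by
  obtain ⟨hc, hne, hmax⟩ := hG
  let f := Fintype.equivFin V
  let H : SimpleGraph (Fin (Fintype.card V)) := G.comap f.symm
  let e : G ≃g H := ⟨f, by intro a b; simp [H]⟩
  have hH : H.Connected := e.connected_iff.1 hc
  have hr : graphRadius H = graphRadius G := le_antisymm (iso_radius e hc) (iso_radius e.symm hH)
  refine ⟨_, H, ⟨hH, ?_, ?_⟩, hr, le_antisymm (iso_diam e hc) (iso_diam e.symm hH)⟩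
  · intro h
    apply hne
    ext a b
    have : H.Adj (f a) (f b) ↔ f a ≠ f b := by rw [h, SimpleGraph.top_adj]
    simpa [H] using this
  · intro u v huv hadj
    have h1 := hmax (f.symm u) (f.symm v) (by simpa using huv) hadj
    rw [hr]
    refine lt_of_le_of_lt ?_ h1
    refine iso_radius (G := G ⊔ SimpleGraph.edge (f.symm u) (f.symm v)) ⟨f, ?_⟩
      (sup_edge_connected hc _ _)
    intro a b
    simp [H, SimpleGraph.edge_adj, Equiv.eq_symm_apply]

end transfer

abbrev Vt (N h : ℕ) : Type := {p : ℕ × ℕ // p.1 < N ∧ p.2 ≤ h ∧ (p.2 = 0 ∨ p.1 % 2 = 0)}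

instance (N h : ℕ) : Finite (Vt N h) := by
  refine Set.Finite.subset ((Set.finite_Iio N).prod (Set.finite_Iic h)) ?_
  rintro ⟨a, b⟩ ⟨h1, h2, _⟩
  exact ⟨h1, h2⟩

noncomputable instance (N h : ℕ) : Fintype (Vt N h) := Fintype.ofFinite _

def AdjP (N a k b l : ℕ) : Prop :=
  (a = b ∧ (k + 1 = l ∨ l + 1 = k)) ∨
  (k = 0 ∧ l = 0 ∧ a ≠ b ∧ (a + 1 = b ∨ b + 1 = a ∨ (a = 0 ∧ b + 1 = N) ∨ (b = 0 ∧ a + 1 = N))) ∨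
  (a = 1 ∧ k = 0 ∧ b = 0 ∧ l = 1) ∨ (b = 1 ∧ l = 0 ∧ a = 0 ∧ k = 1)

lemma adjP_symm {N a k b l : ℕ} (hN : AdjP N a k b l) : AdjP N b l a k := by
  rcases hN with ⟨h1, h2⟩ | ⟨h1, h2, h3, h4⟩ | h1 | h1
  · exact Or.inl ⟨h1.symm, h2.symm⟩
  · refine Or.inr (Or.inl ⟨h2, h1, h3.symm, ?_⟩)
    rcases h4 with h4 | h4 | h4 | h4
    · exact Or.inr (Or.inl h4)
    · exact Or.inl h4
    · exact Or.inr (Or.inr (Or.inr h4))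
    · exact Or.inr (Or.inr (Or.inl h4))
  · exact Or.inr (Or.inr (Or.inr h1))
  · exact Or.inr (Or.inr (Or.inl h1))

def gr (N h : ℕ) : SimpleGraph (Vt N h) where
  Adj u w := AdjP N u.1.1 u.1.2 w.1.1 w.1.2
  symm := ⟨by
    intro u w h
    exact adjP_symm h⟩
  loopless := ⟨by
    intro u
    simp only [AdjP]
    omega⟩

lemma gr_adj {N h : ℕ} {u w : Vt N h} :
    (gr N h).Adj u w ↔ AdjP N u.1.1 u.1.2 w.1.1 w.1.2 := Iff.rfl

lemma Vt.ext' {N h : ℕ} {u w : Vt N h} (h1 : u.1.1 = w.1.1) (h2 : u.1.2 = w.1.2) : u = w :=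
  Subtype.ext (Prod.ext h1 h2)

def mk {N h : ℕ} (a k : ℕ) (h1 : a < N) (h2 : k ≤ h) (h3 : k = 0 ∨ a % 2 = 0) : Vt N h :=
  ⟨(a, k), h1, h2, h3⟩

lemma cyc_spec {N a b : ℕ} (ha : a < N) (hb : b < N) :
    (a ≤ b ∧ 2 * b ≤ N + 2 * a ∧ cyc N a b + a = b) ∨
    (a ≤ b ∧ N + 2 * a ≤ 2 * b ∧ cyc N a b + b = N + a) ∨
    (b ≤ a ∧ 2 * a ≤ N + 2 * b ∧ cyc N a b + b = a) ∨
    (b ≤ a ∧ N + 2 * b ≤ 2 * a ∧ cyc N a b + a = N + b) := by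
  unfold cyc
  rcases Nat.le_total a b with h | h
  · by_cases h2 : 2 * b ≤ N + 2 * a <;> omega
  · by_cases h2 : 2 * a ≤ N + 2 * b <;> omega

lemma U1 {N h : ℕ} (hN : 3 ≤ N) (u : Vt N h) (hu : u.1.2 = 0) (w : Vt N h) :
    (gr N h).Reachable u w ∧ (gr N h).dist u w ≤ cyc N u.1.1 w.1.1 + w.1.2 := by
  refine descend u (fun _ => True) (fun w => cyc N u.1.1 w.1.1 + w.1.2) ?_ _ w trivial le_rfl
  rintro ⟨⟨b, l⟩, h1, h2, h3⟩ -
  obtain ⟨⟨a, k⟩, h4, h5, h6⟩ := u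
  simp only at hu h1 h2 h3 h4 h5 h6 ⊢
  subst hu
  by_cases hl : l = 0
  · subst hl
    by_cases hab : b = a
    · left; subst hab; rfl
    · right
      obtain ⟨c, hc, hc1, hc2⟩ : ∃ c, c < N ∧ AdjP N c 0 b 0 ∧ cyc N a c < cyc N a b := by
        by_cases q1 : a < b
        · by_cases q2 : b - a ≤ N - (b - a)
          · exact ⟨b - 1, by omega, by unfold AdjP; omega, by unfold cyc; omega⟩
          · by_cases q3 : b + 1 = N
            · exact ⟨0, by omega, by unfold AdjP; omega, by unfold cyc; omega⟩
            · exact ⟨b + 1, by omega, by unfold AdjP; omega, by unfold cyc; omega⟩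
        · by_cases q2 : a - b ≤ N - (a - b)
          · exact ⟨b + 1, by omega, by unfold AdjP; omega, by unfold cyc; omega⟩
          · by_cases q3 : b = 0
            · exact ⟨N - 1, by omega, by unfold AdjP; omega, by unfold cyc; omega⟩
            · exact ⟨b - 1, by omega, by unfold AdjP; omega, by unfold cyc; omega⟩
      exact ⟨⟨(c, 0), hc, h2, Or.inl rfl⟩, trivial, hc1, by simpa using hc2⟩
  · right
    refine ⟨mk b (l - 1) h1 (by omega) (by omega), trivial, ?_, ?_⟩
    · change AdjP N b (l - 1) b l
      unfold AdjP; omega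
    · simp only [mk]; omega

lemma gr_conn {N h : ℕ} (hN : 3 ≤ N) : (gr N h).Connected := by
  have : Nonempty (Vt N h) := ⟨mk 0 0 (by omega) (by omega) (by omega)⟩
  rw [SimpleGraph.connected_iff_exists_forall_reachable]
  exact ⟨mk 0 0 (by omega) (by omega) (by omega), fun w => (U1 hN _ rfl w).1⟩

lemma U2 {N h : ℕ} (u w : Vt N h) (huw : u.1.1 = w.1.1) (hl : u.1.2 ≤ w.1.2) :
    (gr N h).dist u w ≤ w.1.2 - u.1.2 := by
  refine (descend u (fun w => u.1.1 = w.1.1 ∧ u.1.2 ≤ w.1.2) (fun w => w.1.2 - u.1.2) ?_ _ w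
    ⟨huw, hl⟩ le_rfl).2
  rintro ⟨⟨b, l⟩, h1, h2, h3⟩ ⟨h4, h5⟩
  by_cases hl : l = u.1.2
  · left
    exact Vt.ext' h4.symm hl
  · right
    simp only at h1 h2 h3 h4 h5 ⊢
    refine ⟨mk b (l - 1) h1 (by omega) (by omega),
      ⟨h4, by simp only [mk]; omega⟩, ?_, ?_⟩
    · change AdjP N b (l - 1) b l
      unfold AdjP; omega
    · simp only [mk]; omega

lemma U3 {N h : ℕ} (hN : 3 ≤ N) (u : Vt N h) (hu : u.1.2 = 0) (w : Vt N h) (hw : w.1.1 = 0)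
    (hw2 : 1 ≤ w.1.2) : (gr N h).dist u w ≤ cyc N u.1.1 1 + w.1.2 := by
  have hh := w.2.2.1
  let x : Vt N h := mk (1) (0) (by omega) (by omega) (by omega)
  let y : Vt N h := mk (0) (1) (by omega) (by omega) (by omega)
  have h1 := (U1 hN u hu x).2
  have h2 : (gr N h).dist x y = 1 := by
    rw [SimpleGraph.dist_eq_one_iff_adj, gr_adj]
    simp [AdjP, x, y, mk]
  have h3 := U2 y w hw.symm hw2
  have h4 := (gr_conn (h := h) hN).dist_triangle (u := u) (v := x) (w := w)
  have h5 := (gr_conn (h := h) hN).dist_triangle (u := x) (v := y) (w := w)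
  simp only [x, y, mk] at *
  omega

lemma U4 {N h : ℕ} (hN : 3 ≤ N) (u w : Vt N h) :
    (gr N h).dist u w ≤ u.1.2 + cyc N u.1.1 w.1.1 + w.1.2 := by
  have hu := u.2
  let x : Vt N h := mk (u.1.1) (0) (by omega) (by omega) (by omega)
  have h1 := U2 x u rfl (Nat.zero_le _)
  have h2 := (U1 hN x rfl w).2
  have h4 := (gr_conn (h := h) hN).dist_triangle (u := u) (v := x) (w := w)
  rw [SimpleGraph.dist_comm (u := u) (v := x)] at h4
  simp only [x, mk] at *
  omega

lemma adjP_lip {N a k b l t : ℕ} (ha : a < N) (hb : b < N) (ht : t < N) (h : AdjP N a k b l)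
    : cyc N b t ≤ cyc N a t + 1 := by
  have h1 := cyc_spec ha ht
  have h2 := cyc_spec hb ht
  unfold AdjP at h
  rcases h1 with h1 | h1 | h1 | h1 <;> rcases h2 with h2 | h2 | h2 | h2 <;> omega

lemma cyc_le {N a b : ℕ} : 2 * cyc N a b ≤ N := by
  unfold cyc; omega

lemma cyc_comm {N a b : ℕ} : cyc N a b = cyc N b a := by
  unfold cyc; omega

lemma nonadj_cyc {N a b : ℕ} (ha : a < N) (hb : b < N)
    (hab : a ≠ b) (h : ¬ AdjP N a 0 b 0) : 2 ≤ cyc N a b := by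
  by_contra hlt
  apply h
  have h1 := cyc_spec ha hb
  have h2 : cyc N a b ≤ 1 := by omega
  clear h hlt
  unfold AdjP
  right; left
  refine ⟨rfl, rfl, hab, ?_⟩
  rcases h1 with h1 | h1 | h1 | h1 <;> omega

lemma even_arith {r a b c : ℕ} (hr : 2 ≤ r) (ha : a < 2 * r) (hb : b < 2 * r) (hc : c < 2 * r)
    (hab : a ≠ b) (h : ¬ AdjP (2 * r) a 0 b 0) :
    cyc (2 * r) a c ≤ r - 1 ∨ 1 + cyc (2 * r) b c ≤ r - 1 := by
  have h1 := cyc_spec ha hc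
  have h2 := cyc_spec hb hc
  have h3 := cyc_spec ha hb
  have h4 := nonadj_cyc ha hb hab h
  clear h
  by_contra hcon
  have h5 : r ≤ cyc (2 * r) a c := by omega
  have h6 : r ≤ 1 + cyc (2 * r) b c := by omega
  clear hcon
  rcases h1 with h1 | h1 | h1 | h1 <;> rcases h2 with h2 | h2 | h2 | h2 <;>
    rcases h3 with h3 | h3 | h3 | h3 <;> omega

lemma even_case (r : ℕ) (hr : 2 ≤ r) : RadiallyMaximal (gr (2 * r) 0) ∧
    graphRadius (gr (2 * r) 0) = r ∧ graphDiam (gr (2 * r) 0) = r := by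
  have hN : 3 ≤ 2 * r := by omega
  have hc := gr_conn (h := 0) hN
  have := hc.nonempty
  have hup : graphDiam (gr (2 * r) 0) ≤ r := by
    refine diam_le fun u w => (U4 hN u w).trans ?_
    have := u.2
    have := w.2
    have := cyc_le (N := 2 * r) (a := u.1.1) (b := w.1.1)
    omega
  have hlow : r ≤ graphRadius (gr (2 * r) 0) := by
    refine le_radius fun v => ?_
    have hv := v.2
    obtain ⟨t, ht, htr⟩ : ∃ t, t < 2 * r ∧ cyc (2 * r) v.1.1 t = r := by
      simp only [cyc]
      by_cases h : v.1.1 < r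
      · exact ⟨v.1.1 + r, by omega, by omega⟩
      · exact ⟨v.1.1 - r, by omega, by omega⟩
    refine ⟨mk t 0 ht le_rfl (Or.inl rfl), ?_⟩
    have := lip hc (fun u => cyc (2 * r) u.1.1 t) (fun a b hab => adjP_lip a.2.1 b.2.1 ht hab)
      (mk t 0 ht le_rfl (Or.inl rfl)) v
    rw [SimpleGraph.dist_comm] at this
    have h0 : cyc (2 * r) t t = 0 := by unfold cyc; omega
    simp only [mk, h0, htr, zero_add] at this
    exact this
  have hrd := radius_le_diam (gr (2 * r) 0)
  have hR : graphRadius (gr (2 * r) 0) = r := by omega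
  refine ⟨⟨hc, ?_, ?_⟩, hR, by omega⟩
  · intro h
    have : (gr (2 * r) 0).Adj (mk 0 0 (by omega) (by omega) (by omega))
        (mk 2 0 (by omega) (by omega) (by omega)) := by
      rw [h, SimpleGraph.top_adj]
      simp [mk]
    rw [gr_adj] at this
    simp only [mk, AdjP] at this
    omega
  · intro x y hxy hadj
    rw [hR]
    suffices graphRadius (gr (2 * r) 0 ⊔ SimpleGraph.edge x y) ≤ r - 1 by omega
    refine radius_le x fun w => ?_
    have h1 := sup_edge_dist hc x y x w
    have h2 := sup_edge_dist' hc x y x w hxy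
    have h3 := U4 hN x w
    have h4 := U4 hN y w
    have h5 : (gr (2 * r) 0).dist x x = 0 := by simp
    have hx := x.2
    have hy := y.2
    have hw := w.2
    have hxy' : ¬ (x.1.1 = y.1.1) := fun h => hxy (Vt.ext' h (by omega))
    rw [gr_adj] at hadj
    have hx0 : x.1.2 = 0 := by omega
    have hy0 : y.1.2 = 0 := by omega
    rw [hx0, hy0] at hadj
    have h6 := even_arith hr hx.1 hy.1 hw.1 hxy' hadj
    omega

section odd
variable {q h : ℕ}

/-- `t` is the base of the unique tail whose end is farthest from the cycle vertex `j`. -/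
def Far (q j t : ℕ) : Prop := (t ≠ 0 ∧ cyc (2 * q + 1) j t = q) ∨ (t = 0 ∧ j = q + 1)

lemma cyc_max {q j b t : ℕ} (hj : j < 2 * q + 1) (hb : b < 2 * q + 1) (ht : t < 2 * q + 1)
    (hbe : b % 2 = 0) (hte : t % 2 = 0) (h1 : cyc (2 * q + 1) j t = q)
    (h2 : q ≤ cyc (2 * q + 1) j b) (ht0 : t ≠ 0) :
    b = t ∨ b = 0 := by
  have h3 := cyc_spec hj ht
  have h4 := cyc_spec hj hb
  rcases h3 with h3 | h3 | h3 | h3 <;> rcases h4 with h4 | h4 | h4 | h4 <;> omega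

lemma cyc_max0 {q j t : ℕ} (hq : 2 ≤ q) (hj : j < 2 * q + 1) (ht : t < 2 * q + 1)
    (hte : t % 2 = 0) (h1 : cyc (2 * q + 1) j t = q) (ht0 : t ≠ 0)
    (h2 : q ≤ cyc (2 * q + 1) j 0) (h3 : q ≤ cyc (2 * q + 1) j 1) : False := by
  have h4 := cyc_spec hj ht
  have h5 := cyc_spec hj (show 0 < 2 * q + 1 by omega)
  have h6 := cyc_spec hj (show 1 < 2 * q + 1 by omega)
  have h7 : j = q + 1 := by
    rcases h5 with h5 | h5 | h5 | h5 <;> rcases h6 with h6 | h6 | h6 | h6 <;> omega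
  rcases h4 with h4 | h4 | h4 | h4 <;> omega

lemma cyc_q1 {q b : ℕ} (hb : b < 2 * q + 1) (h2 : q ≤ cyc (2 * q + 1) (q + 1) b) :
    b = 0 ∨ b = 1 := by
  unfold cyc at h2
  omega

lemma center (hq : 2 ≤ q) (hh : 1 ≤ h) (x y c w : Vt (2 * q + 1) h) (hc : c.1.2 = 0)
    (hw : w.1.2 = h) (hF : Far q c.1.1 w.1.1)
    (hd : (gr (2 * q + 1) h ⊔ SimpleGraph.edge x y).dist c w ≤ q + h - 1) :
    graphRadius (gr (2 * q + 1) h ⊔ SimpleGraph.edge x y) < q + h := by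
  have hN : 3 ≤ 2 * q + 1 := by omega
  suffices graphRadius (gr (2 * q + 1) h ⊔ SimpleGraph.edge x y) ≤ q + h - 1 by omega
  refine radius_le c fun u => ?_
  by_cases huw : u = w
  · rw [huw]; exact hd
  refine (sup_edge_dist (gr_conn hN) x y c u).trans ?_
  have h1 := (U1 hN c hc u).2
  have h2 := U3 hN c hc u
  have h3 := cyc_le (N := 2 * q + 1) (a := c.1.1) (b := u.1.1)
  have h4 := cyc_le (N := 2 * q + 1) (a := c.1.1) (b := 1)
  have hu := u.2
  have hw' := w.2
  by_contra hcon
  have e1 : q ≤ cyc (2 * q + 1) c.1.1 u.1.1 := by omega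
  have e2 : u.1.2 = h := by omega
  have e3 : u.1.1 ≠ w.1.1 := fun hne => huw (Vt.ext' hne (by omega))
  rcases hF with ⟨f1, f2⟩ | ⟨f1, f2⟩
  · rcases cyc_max c.2.1 hu.1 hw'.1 (by omega) (by omega) f2 e1 f1 with h5 | h5
    · exact e3 h5
    · have h6 := h2 h5 (by omega)
      rw [h5] at e1
      exact cyc_max0 hq c.2.1 hw'.1 (by omega) f2 f1 e1 (by omega)
  · rw [f2] at e1
    have := cyc_q1 hu.1 e1
    omega

/-- Shortcut into a tail. -/
lemma tailred (hq : 2 ≤ q) (hh : 1 ≤ h) (x y : Vt (2 * q + 1) h) (hxy : x ≠ y)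
    (j : ℕ) (hj : j < 2 * q + 1) (hb : y.1.1 % 2 = 0) (hF : Far q j y.1.1)
    (hm : cyc (2 * q + 1) j x.1.1 + x.1.2 + 2 ≤ q + y.1.2 ∨
      (x.1.1 = 0 ∧ 1 ≤ x.1.2 ∧ cyc (2 * q + 1) j 1 + x.1.2 + 2 ≤ q + y.1.2)) :
    graphRadius (gr (2 * q + 1) h ⊔ SimpleGraph.edge x y) < q + h := by
  have hN : 3 ≤ 2 * q + 1 := by omega
  have hy := y.2
  let c : Vt (2 * q + 1) h := mk j 0 hj (by omega) (by omega)
  let w : Vt (2 * q + 1) h := mk y.1.1 h hy.1 le_rfl (Or.inr hb)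
  refine center hq hh x y c w rfl rfl hF ?_
  refine (sup_edge_dist' (gr_conn hN) x y c w hxy).trans ?_
  have h1 : (gr (2 * q + 1) h).dist y w ≤ h - y.1.2 := U2 y w rfl hy.2.1
  have h2 : (gr (2 * q + 1) h).dist c x ≤ cyc (2 * q + 1) j x.1.1 + x.1.2 := (U1 hN c rfl x).2
  rcases hm with hm | ⟨m1, m2, hm⟩
  · omega
  · have h3 : (gr (2 * q + 1) h).dist c x ≤ cyc (2 * q + 1) j 1 + x.1.2 := U3 hN c rfl x m1 m2
    omega

/-- Shortcut in the cycle. -/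
lemma basered (hq : 2 ≤ q) (hh : 1 ≤ h) (x y : Vt (2 * q + 1) h) (hxy : x ≠ y)
    (hx : x.1.2 = 0) (hy : y.1.2 = 0)
    (j t : ℕ) (hj : j < 2 * q + 1) (ht : t < 2 * q + 1) (hte : t % 2 = 0) (hF : Far q j t)
    (hm : cyc (2 * q + 1) j x.1.1 + cyc (2 * q + 1) y.1.1 t + 2 ≤ q ∨
      (t = 0 ∧ cyc (2 * q + 1) j x.1.1 + cyc (2 * q + 1) y.1.1 1 + 2 ≤ q)) :
    graphRadius (gr (2 * q + 1) h ⊔ SimpleGraph.edge x y) < q + h := by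
  have hN : 3 ≤ 2 * q + 1 := by omega
  let c : Vt (2 * q + 1) h := mk j 0 hj (by omega) (by omega)
  let w : Vt (2 * q + 1) h := mk t h ht le_rfl (Or.inr hte)
  refine center hq hh x y c w rfl rfl hF ?_
  refine (sup_edge_dist' (gr_conn hN) x y c w hxy).trans ?_
  have h1 : (gr (2 * q + 1) h).dist y w ≤ cyc (2 * q + 1) y.1.1 t + h := (U1 hN y hy w).2
  have h2 : (gr (2 * q + 1) h).dist c x ≤ cyc (2 * q + 1) j x.1.1 + x.1.2 := (U1 hN c rfl x).2
  rcases hm with hm | ⟨m1, hm⟩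
  · omega
  · have h3 : (gr (2 * q + 1) h).dist y w ≤ cyc (2 * q + 1) y.1.1 1 + h := U3 hN y hy w m1 hh
    omega

lemma cyc_up {N a b : ℕ} (hab : a ≤ b) : cyc N a b ≤ b - a ∧ cyc N a b ≤ N - (b - a) := by
  unfold cyc; omega

/-- The antipodes of `t` in both directions. -/
lemma anti {q t : ℕ} (hq : 2 ≤ q) (ht : t < 2 * q + 1) :
    ∃ j, j < 2 * q + 1 ∧ cyc (2 * q + 1) j t = q ∧ (j = t + q ∨ j + q + 1 = t) := by
  by_cases h1 : t + q < 2 * q + 1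
  · exact ⟨t + q, h1, by unfold cyc; omega, by omega⟩
  · exact ⟨t - q - 1, by omega, by unfold cyc; omega, by omega⟩

lemma anti' {q t : ℕ} (hq : 2 ≤ q) (ht : t < 2 * q + 1) :
    ∃ j, j < 2 * q + 1 ∧ cyc (2 * q + 1) j t = q ∧ (j + q = t ∨ j = t + q + 1) := by
  by_cases h1 : q ≤ t
  · exact ⟨t - q, by omega, by unfold cyc; omega, by omega⟩
  · exact ⟨t + q + 1, by omega, by unfold cyc; omega, by omega⟩

/-- distances from `t + q` -/
lemma anti_far {q t j a : ℕ} (hq : 2 ≤ q) (ht : t < 2 * q + 1) (ha : a < 2 * q + 1)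
    (hj' : j < 2 * q + 1) (hj : j = t + q ∨ j + q + 1 = t) :
    (cyc (2 * q + 1) j a ≤ q) ∧
    (q ≤ cyc (2 * q + 1) j a → a = t ∨ a + 1 = t ∨ (a = 2 * q ∧ t = 0)) ∧
    (q ≤ cyc (2 * q + 1) j a + 1 → a = t ∨ a + 1 = t ∨ (a = 2 * q ∧ t = 0) ∨
      a + 2 = t ∨ a + 2 = t + (2 * q + 1) ∨ a = t + 1 ∨ a + 2 * q = t) := by
  have h := cyc_spec hj' ha
  rcases h with h | h | h | h <;> rcases hj with hj | hj <;>
    exact ⟨by omega, fun h => by omega, fun h => by omega⟩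

lemma anti_far' {q t j a : ℕ} (hq : 2 ≤ q) (ht : t < 2 * q + 1) (ha : a < 2 * q + 1)
    (hj' : j < 2 * q + 1) (hj : j + q = t ∨ j = t + q + 1) :
    (cyc (2 * q + 1) j a ≤ q) ∧
    (q ≤ cyc (2 * q + 1) j a → a = t ∨ a = t + 1 ∨ (a = 0 ∧ t = 2 * q)) ∧
    (q ≤ cyc (2 * q + 1) j a + 1 → a = t ∨ a = t + 1 ∨ (a = 0 ∧ t = 2 * q) ∨
      a = t + 2 ∨ a + (2 * q + 1) = t + 2 ∨ a + 1 = t ∨ a = t + 2 * q) := by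
  have h := cyc_spec hj' ha
  rcases h with h | h | h | h <;> rcases hj with hj | hj <;>
    exact ⟨by omega, fun h => by omega, fun h => by omega⟩

end odd

section odd2
variable {q h : ℕ}

lemma q1_le {q a : ℕ} : cyc (2 * q + 1) (q + 1) a ≤ q := by
  unfold cyc; omega

lemma caseT (hq : 2 ≤ q) (hh : 1 ≤ h) (x y : Vt (2 * q + 1) h) (hxy : x ≠ y)
    (hadj : ¬ AdjP (2 * q + 1) x.1.1 x.1.2 y.1.1 y.1.2) (hy : 1 ≤ y.1.2) (hxl : x.1.2 ≤ y.1.2)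
    (hne : x.1.2 = y.1.2 → y.1.1 ≠ 0) :
    graphRadius (gr (2 * q + 1) h ⊔ SimpleGraph.edge x y) < q + h := by
  have hx' := x.2
  have hy' := y.2
  have hb : y.1.1 % 2 = 0 := by omega
  have same : x.1.1 = y.1.1 → x.1.2 + 2 ≤ y.1.2 := by
    intro h1
    have h2 : x.1.2 ≠ y.1.2 := fun h2 => hxy (Vt.ext' h1 h2)
    have h3 : x.1.2 + 1 ≠ y.1.2 := fun h3 => hadj (Or.inl ⟨h1, Or.inl h3⟩)
    omega
  have one : x.1.1 = 1 → y.1.1 = 0 → 2 ≤ y.1.2 := by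
    intro h1 h2
    by_contra h3
    exact hadj (Or.inr (Or.inr (Or.inl ⟨h1, by omega, h2, by omega⟩)))
  clear hadj
  by_cases b0 : y.1.1 = 0
  · refine tailred hq hh x y hxy (q + 1) (by omega) hb (Or.inr ⟨b0, rfl⟩) (Or.inl ?_)
    have h1 := q1_le (q := q) (a := x.1.1)
    by_cases h2 : q ≤ cyc (2 * q + 1) (q + 1) x.1.1
    · rcases cyc_q1 hx'.1 h2 with h3 | h3
      · have := same (by omega)
        omega
      · have := one h3 b0
        omega
    · omega
  obtain ⟨j, j1, j2, j3⟩ := anti hq hy'.1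
  obtain ⟨i, i1, i2, i3⟩ := anti' hq hy'.1
  have Tj := tailred hq hh x y hxy j j1 hb (Or.inl ⟨b0, j2⟩)
  have Ti := tailred hq hh x y hxy i i1 hb (Or.inl ⟨b0, i2⟩)
  obtain ⟨a1, a2, a3⟩ := anti_far hq hy'.1 hx'.1 j1 j3
  obtain ⟨c1, c2, c3⟩ := anti_far' hq hy'.1 hx'.1 i1 i3
  obtain ⟨d1, d2, d3⟩ := anti_far (a := 1) hq hy'.1 (by omega) j1 j3
  have hxp : 1 ≤ x.1.2 → x.1.1 % 2 = 0 := by intro h1; clear Tj Ti a2 a3 c2 c3 d2 d3 same one; omega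
  have hx1 := hx'.1
  have hy1 := hy'.1
  clear hx' hy' hne i2 j2 i3 j3 one
  by_cases hab : x.1.1 = y.1.1
  · have s1 := same hab
    refine Tj (Or.inl ?_)
    clear Tj Ti a2 a3 c2 c3 d2 d3 same hxp
    omega
  clear same
  by_cases hkl : x.1.2 < y.1.2
  · by_cases h1 : x.1.1 + 1 = y.1.1
    · refine Ti (Or.inl ?_)
      clear Tj Ti a2 a3 c3 d2 d3 hxp
      by_contra h2
      have h3 : q ≤ cyc (2 * q + 1) i x.1.1 := by clear c2; omega
      have h4 := c2 h3
      clear c2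
      omega
    · refine Tj (Or.inl ?_)
      clear Tj Ti c2 c3 a3 d2 d3 hxp
      by_contra h2
      have h3 : q ≤ cyc (2 * q + 1) j x.1.1 := by clear a2; omega
      have h4 := a2 h3
      clear a2
      omega
  have hke : x.1.2 = y.1.2 := by clear Tj Ti a2 a3 c2 c3 d2 d3 hxp; omega
  have hxe := hxp (by rw [hke]; exact hy)
  clear hxp a2 c2 d2
  by_cases a0 : x.1.1 = 0
  · by_cases b2 : y.1.1 = 2
    · refine Ti (Or.inl ?_)
      clear Tj Ti a3 d3
      by_contra h2
      have h3 : q ≤ cyc (2 * q + 1) i x.1.1 + 1 := by clear c3; omega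
      have h4 := c3 h3
      clear c3 h3 h2
      omega
    · refine Tj (Or.inr ⟨a0, by rw [hke]; exact hy, ?_⟩)
      clear Tj Ti a3 c3
      by_contra h2
      have h3 : q ≤ cyc (2 * q + 1) j 1 + 1 := by clear d3; omega
      have h4 := d3 h3
      clear d3 h3 h2
      omega
  · by_cases h1 : x.1.1 + 2 = y.1.1
    · refine Ti (Or.inl ?_)
      clear Tj Ti a3 d3
      by_contra h2
      have h3 : q ≤ cyc (2 * q + 1) i x.1.1 + 1 := by clear c3; omega
      have h4 := c3 h3
      clear c3 h3 h2
      omega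
    · refine Tj (Or.inl ?_)
      clear Tj Ti c3 d3
      by_contra h2
      have h3 : q ≤ cyc (2 * q + 1) j x.1.1 + 1 := by clear a3; omega
      have h4 := a3 h3
      clear a3 h3 h2
      omega

def Ok (q j t x y : ℕ) : Prop := cyc (2 * q + 1) j x + cyc (2 * q + 1) y t + 2 ≤ q ∨
      (t = 0 ∧ cyc (2 * q + 1) j x + cyc (2 * q + 1) y 1 + 2 ≤ q)

lemma cyc_le1 {N a b m : ℕ} (h : a ≤ b + m) (h' : b ≤ a + m) : cyc N a b ≤ m := by
  unfold cyc; omega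

lemma cyc_le2 {N a b m : ℕ} (h : N ≤ a - b + (b - a) + m) : cyc N a b ≤ m := by
  unfold cyc; omega

/-- witness via the antipode `t - q` of `t`; `s` arc start, `e` arc end -/
lemma Ok_anti' {q t x y m n : ℕ} (hq : 2 ≤ q) (ht : t < 2 * q + 1) (ht0 : t ≠ 0)
    (hte : t % 2 = 0) (hx : x < 2 * q + 1)
    (h1 : x + m = t ∨ x + m = t + (2 * q + 1))
    (hm : m ≤ q) (hn : cyc (2 * q + 1) y t ≤ n) (hmn : n + 2 ≤ m) :
    ∃ j t, j < 2 * q + 1 ∧ t < 2 * q + 1 ∧ t % 2 = 0 ∧ Far q j t ∧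
      (Ok q j t x y) := by
  obtain ⟨i, i1, i2, i3⟩ := anti' hq ht
  refine ⟨i, t, i1, ht, hte, Or.inl ⟨ht0, i2⟩, Or.inl ?_⟩
  have : cyc (2 * q + 1) i x ≤ q - m := by
    rcases h1 with h1 | h1 <;> rcases i3 with i3 | i3
    · exact cyc_le1 (by omega) (by omega)
    · exact cyc_le2 (by omega)
    · exact cyc_le2 (by omega)
    · exact cyc_le1 (by omega) (by omega)
  omega

lemma Ok_anti {q t x y m n : ℕ} (hq : 2 ≤ q) (ht : t < 2 * q + 1) (ht0 : t ≠ 0)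
    (hte : t % 2 = 0) (hx : x < 2 * q + 1)
    (h1 : t + m = x ∨ t + m = x + (2 * q + 1))
    (hm : m ≤ q) (hn : cyc (2 * q + 1) y t ≤ n) (hmn : n + 2 ≤ m) :
    ∃ j t, j < 2 * q + 1 ∧ t < 2 * q + 1 ∧ t % 2 = 0 ∧ Far q j t ∧
      (Ok q j t x y) := by
  obtain ⟨i, i1, i2, i3⟩ := anti hq ht
  refine ⟨i, t, i1, ht, hte, Or.inl ⟨ht0, i2⟩, Or.inl ?_⟩
  have : cyc (2 * q + 1) i x ≤ q - m := by
    rcases h1 with h1 | h1 <;> rcases i3 with i3 | i3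
    · exact cyc_le1 (by omega) (by omega)
    · exact cyc_le2 (by omega)
    · exact cyc_le2 (by omega)
    · exact cyc_le1 (by omega) (by omega)
  omega

lemma Ok_zero {q x y : ℕ} (hq : 2 ≤ q) (hy : y = 0 ∨ y = 1)
    (hx : x = q + 1 ∨ ((x = q ∨ x = q + 2) ∧ 3 ≤ q)) :
    ∃ j t, j < 2 * q + 1 ∧ t < 2 * q + 1 ∧ t % 2 = 0 ∧ Far q j t ∧
      (Ok q j t x y) := by
  refine ⟨q + 1, 0, by omega, by omega, rfl, Or.inr ⟨rfl, rfl⟩, ?_⟩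
  have h1 : cyc (2 * q + 1) (q + 1) x + 2 ≤ q := by
    rcases hx with hx | ⟨hx, h3⟩
    · have := cyc_le1 (N := 2 * q + 1) (a := q + 1) (b := x) (m := 0) (by omega) (by omega)
      omega
    · have := cyc_le1 (N := 2 * q + 1) (a := q + 1) (b := x) (m := 1) (by omega) (by omega)
      omega
  rcases hy with rfl | rfl
  · left
    have := cyc_le1 (N := 2 * q + 1) (a := 0) (b := 0) (m := 0) (by omega) (by omega)
    omega
  · right
    have := cyc_le1 (N := 2 * q + 1) (a := 1) (b := 1) (m := 0) (by omega) (by omega)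
    exact ⟨rfl, by omega⟩

lemma arithD {q a b : ℕ} (hq : 2 ≤ q) (hb : b < 2 * q + 1) (hab : a < b)
    (hc : 2 ≤ cyc (2 * q + 1) a b) :
    (∃ j t, j < 2 * q + 1 ∧ t < 2 * q + 1 ∧ t % 2 = 0 ∧ Far q j t ∧ Ok q j t a b) ∨
    (∃ j t, j < 2 * q + 1 ∧ t < 2 * q + 1 ∧ t % 2 = 0 ∧ Far q j t ∧ Ok q j t b a) := by
  have hbb : cyc (2 * q + 1) b b ≤ 0 := cyc_le1 (by omega) (by omega)
  have haa : cyc (2 * q + 1) a a ≤ 0 := cyc_le1 (by omega) (by omega)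
  have hbp : cyc (2 * q + 1) b (b + 1) ≤ 1 := cyc_le1 (by omega) (by omega)
  have hap : cyc (2 * q + 1) a (a + 1) ≤ 1 := cyc_le1 (by omega) (by omega)
  have hbm : cyc (2 * q + 1) b (b - 1) ≤ 1 := cyc_le1 (by omega) (by omega)
  have hm1 : a + 2 ≤ b ∧ b + 1 ≤ a + 2 * q := by
    unfold cyc at hc; omega
  clear hc
  by_cases hm : b ≤ a + q
  · by_cases be : b % 2 = 0
    · left
      exact Ok_anti' (t := b) (m := b - a) hq hb (by omega) be (by omega) (by omega) (by omega) hbb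
        (by omega)
    by_cases ae : a % 2 = 0 ∧ a ≠ 0
    · right
      exact Ok_anti (t := a) (m := b - a) hq (by omega) ae.2 ae.1 (by omega) (by omega) (by omega)
        haa (by omega)
    by_cases hmq : b + 1 ≤ a + q
    · left
      exact Ok_anti' (t := b + 1) (m := b + 1 - a) hq (by omega) (by omega) (by omega) (by omega)
        (by omega) (by omega) hbp (by omega)
    by_cases a1 : a ≤ 1
    · right
      exact Ok_zero hq (by omega) (by omega)
    · left
      refine ⟨a + 1, b + 1, by omega, by omega, by omega, Or.inl ⟨by omega, ?_⟩, Or.inl ?_⟩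
      · unfold cyc; omega
      · have := cyc_le1 (N := 2 * q + 1) (a := a + 1) (b := a) (m := 1) (by omega) (by omega)
        omega
  · by_cases ae : a % 2 = 0 ∧ a ≠ 0
    · right
      exact Ok_anti' (t := a) (m := 2 * q + 1 + a - b) hq (by omega) ae.2 ae.1 (by omega) (by omega)
        (by omega) haa (by omega)
    by_cases be : b % 2 = 0
    · left
      exact Ok_anti (t := b) (m := 2 * q + 1 + a - b) hq hb (by omega) be (by omega) (by omega)
        (by omega) hbb (by omega)
    by_cases a0 : a = 0
    · by_cases hM : b = q + 1
      · right
        exact Ok_zero hq (by omega) (by omega)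
      · left
        exact Ok_anti (t := b - 1) (m := 2 * q + 2 + a - b) hq (by omega) (by omega) (by omega)
          (by omega) (by omega) (by omega) hbm (by omega)
    by_cases hM : b = a + q + 1
    · by_cases a1 : a = 1
      · right
        exact Ok_zero hq (by omega) (by omega)
      · right
        refine ⟨b + 1, a + 1, by omega, by omega, by omega, Or.inl ⟨by omega, ?_⟩, Or.inl ?_⟩
        · unfold cyc; omega
        · have := cyc_le1 (N := 2 * q + 1) (a := b + 1) (b := b) (m := 1) (by omega) (by omega)
          omega
    · right
      exact Ok_anti' (t := a + 1) (m := 2 * q + 2 + a - b) hq (by omega) (by omega) (by omega)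
        (by omega) (by omega) (by omega) hap (by omega)

lemma caseD (hq : 2 ≤ q) (hh : 1 ≤ h) (x y : Vt (2 * q + 1) h)
    (hx : x.1.2 = 0) (hy : y.1.2 = 0) (hab : x.1.1 < y.1.1)
    (hc : 2 ≤ cyc (2 * q + 1) x.1.1 y.1.1) :
    graphRadius (gr (2 * q + 1) h ⊔ SimpleGraph.edge x y) < q + h := by
  have hxy : x ≠ y := by
    rintro rfl
    omega
  rcases arithD hq y.2.1 hab hc with ⟨j, t, h1, h2, h3, h4, h5⟩ | ⟨j, t, h1, h2, h3, h4, h5⟩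
  · exact basered hq hh x y hxy hx hy j t h1 h2 h3 h4 h5
  · rw [SimpleGraph.edge_comm]
    exact basered hq hh y x hxy.symm hy hx j t h1 h2 h3 h4 h5

lemma odd_max (hq : 2 ≤ q) (hh : 1 ≤ h) (x y : Vt (2 * q + 1) h) (hxy : x ≠ y)
    (hadj : ¬ (gr (2 * q + 1) h).Adj x y) :
    graphRadius (gr (2 * q + 1) h ⊔ SimpleGraph.edge x y) < q + h := by
  rw [gr_adj] at hadj
  have hadj' : ¬ AdjP (2 * q + 1) y.1.1 y.1.2 x.1.1 x.1.2 := fun h => hadj (adjP_symm h)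
  by_cases h0 : x.1.2 = 0 ∧ y.1.2 = 0
  · have hne : x.1.1 ≠ y.1.1 := fun h => hxy (Vt.ext' h (by omega))
    rw [h0.1, h0.2] at hadj hadj'
    rcases Nat.lt_or_gt_of_ne hne with hlt | hlt
    · exact caseD hq hh x y h0.1 h0.2 hlt (nonadj_cyc x.2.1 y.2.1 hne hadj)
    · rw [SimpleGraph.edge_comm]
      exact caseD hq hh y x h0.2 h0.1 hlt (nonadj_cyc y.2.1 x.2.1 hne.symm hadj')
  · have hcol : x.1.2 = y.1.2 → x.1.1 ≠ y.1.1 := fun h1 h2 => hxy (Vt.ext' h2 h1)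
    by_cases h1 : x.1.2 < y.1.2 ∨ (x.1.2 = y.1.2 ∧ y.1.1 ≠ 0)
    · exact caseT hq hh x y hxy hadj (by omega) (by omega) (by omega)
    · rw [SimpleGraph.edge_comm]
      exact caseT hq hh y x hxy.symm hadj' (by omega) (by omega) (by omega)

/-- 1-Lipschitz function certifying distances from the end of the tail at `t`. -/
lemma low_pos (hq : 2 ≤ q) (hh : 1 ≤ h) (t s : ℕ) (ht : t < 2 * q + 1) (ht0 : t ≠ 0)
    (hte : t % 2 = 0) (hs : s ≠ 0) (hst : s ≠ t) (v : Vt (2 * q + 1) h) (hv : v.1.1 ≠ t) :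
    h + cyc (2 * q + 1) v.1.1 t + (if v.1.1 = s then v.1.2 else 0) ≤
      (gr (2 * q + 1) h).dist v (mk t h ht le_rfl (Or.inr hte)) := by
  have hN : 3 ≤ 2 * q + 1 := by omega
  have := lip (gr_conn (h := h) hN) (fun u => if u.1.1 = t then h - u.1.2 else
    h + cyc (2 * q + 1) u.1.1 t + (if u.1.1 = s then u.1.2 else 0)) ?_
    (mk t h ht le_rfl (Or.inr hte)) v
  · rw [SimpleGraph.dist_comm] at this
    simp only [mk, if_true, if_neg hv] at this ⊢
    omega
  · intro a b hab
    have h1 := adjP_lip a.2.1 b.2.1 ht hab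
    have hat : a.1.1 = t → cyc (2 * q + 1) a.1.1 t = 0 := by
      intro h; rw [h]; unfold cyc; omega
    have hbt : b.1.1 = t → cyc (2 * q + 1) b.1.1 t = 0 := by
      intro h; rw [h]; unfold cyc; omega
    rw [gr_adj] at hab
    have ha := a.2
    have hb := b.2
    unfold AdjP at hab
    by_cases e : a.1.1 = b.1.1
    · rw [e] at h1 hat hab ⊢
      split_ifs <;> omega
    · have hab' : (a.1.2 = 0 ∧ b.1.2 = 0) ∨ (a.1.1 = 1 ∧ a.1.2 = 0 ∧ b.1.1 = 0 ∧ b.1.2 = 1) ∨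
          (b.1.1 = 1 ∧ b.1.2 = 0 ∧ a.1.1 = 0 ∧ a.1.2 = 1) := by
        rcases hab with hab | hab | hab | hab
        · exact absurd hab.1 e
        · exact Or.inl ⟨hab.1, hab.2.1⟩
        · exact Or.inr (Or.inl hab)
        · exact Or.inr (Or.inr hab)
      clear hab
      split_ifs <;> omega

lemma low_zero (hq : 2 ≤ q) (hh : 1 ≤ h) (v : Vt (2 * q + 1) h) (hv : v.1.1 = q + 1) :
    q + h ≤ (gr (2 * q + 1) h).dist v (mk 0 h (by omega) le_rfl (Or.inr rfl)) := by
  have hN : 3 ≤ 2 * q + 1 := by omega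
  have := lip (gr_conn (h := h) hN) (fun u => if u.1.1 = 0 then h - u.1.2 else
    h + min (u.1.1 - 1) (2 * q + 1 - u.1.1)) ?_
    (mk 0 h (by omega) le_rfl (Or.inr rfl)) v
  · rw [SimpleGraph.dist_comm] at this
    simp only [mk, if_true, hv, Nat.succ_ne_zero, if_false] at this ⊢
    omega
  · intro a b hab
    rw [gr_adj] at hab
    have ha := a.2
    have hb := b.2
    unfold AdjP at hab
    rcases hab with hab | hab | hab | hab <;> split_ifs <;> omega

lemma odd_case (hq : 2 ≤ q) (hh : 1 ≤ h) : RadiallyMaximal (gr (2 * q + 1) h) ∧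
    graphRadius (gr (2 * q + 1) h) = q + h ∧ graphDiam (gr (2 * q + 1) h) = q + 2 * h := by
  have hN : 3 ≤ 2 * q + 1 := by omega
  have hc := gr_conn (h := h) hN
  have := hc.nonempty
  have hup : graphDiam (gr (2 * q + 1) h) ≤ q + 2 * h := by
    refine diam_le fun u w => (U4 hN u w).trans ?_
    have := u.2
    have := w.2
    have := cyc_le (N := 2 * q + 1) (a := u.1.1) (b := w.1.1)
    omega
  have hrup : graphRadius (gr (2 * q + 1) h) ≤ q + h := by
    refine radius_le (mk 0 0 (by omega) (by omega) (by omega)) fun w => (U4 hN _ w).trans ?_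
    have := w.2
    have := cyc_le (N := 2 * q + 1) (a := 0) (b := w.1.1)
    simp only [mk]
    omega
  have hlow : q + h ≤ graphRadius (gr (2 * q + 1) h) := by
    refine le_radius fun v => ?_
    have hv := v.2
    by_cases hv1 : v.1.1 = q + 1
    · exact ⟨_, low_zero hq hh v hv1⟩
    obtain ⟨t, ht, hte, ht0, htq⟩ : ∃ t, t < 2 * q + 1 ∧ t % 2 = 0 ∧ t ≠ 0 ∧
        cyc (2 * q + 1) v.1.1 t = q := by
      by_cases h1 : v.1.1 ≤ q
      · by_cases h2 : (v.1.1 + q) % 2 = 0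
        · exact ⟨v.1.1 + q, by omega, by omega, by omega, by unfold cyc; omega⟩
        · exact ⟨v.1.1 + q + 1, by omega, by omega, by omega, by unfold cyc; omega⟩
      · by_cases h2 : (v.1.1 + q) % 2 = 0
        · exact ⟨v.1.1 - q, by omega, by omega, by omega, by unfold cyc; omega⟩
        · exact ⟨v.1.1 - q - 1, by omega, by omega, by omega, by unfold cyc; omega⟩
    have hvt : v.1.1 ≠ t := by
      rintro h1
      rw [h1] at htq
      unfold cyc at htq
      omega
    have := low_pos hq hh t (2 * q + 1) ht ht0 hte (by omega) (by omega) v hvt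
    exact ⟨_, le_trans (by omega) this⟩
  have hdlow : q + 2 * h ≤ graphDiam (gr (2 * q + 1) h) := by
    obtain ⟨s, hs, hse, hs2, hsq⟩ : ∃ s, s < 2 * q + 1 ∧ s % 2 = 0 ∧ 2 < s ∧
        cyc (2 * q + 1) s 2 = q := by
      by_cases h2 : q % 2 = 0
      · exact ⟨q + 2, by omega, by omega, by omega, by unfold cyc; omega⟩
      · exact ⟨q + 3, by omega, by omega, by omega, by unfold cyc; omega⟩
    have := low_pos hq hh 2 s (by omega) (by omega) rfl (by omega) (by omega)
      (mk s h hs le_rfl (Or.inr hse)) (by simp only [mk]; omega)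
    refine le_trans ?_ (this.trans (dist_le_diam _ _ _))
    simp only [mk, if_true, hsq]
    omega
  have hR : graphRadius (gr (2 * q + 1) h) = q + h := by omega
  refine ⟨⟨hc, ?_, ?_⟩, hR, by omega⟩
  · intro h'
    have : (gr (2 * q + 1) h).Adj (mk 0 0 (by omega) (by omega) (by omega))
        (mk 2 0 (by omega) (by omega) (by omega)) := by
      rw [h', SimpleGraph.top_adj]
      simp [mk]
    rw [gr_adj] at this
    simp only [mk, AdjP] at this
    omega
  · intro x y hxy hadj
    rw [hR]
    exact odd_max hq hh x y hxy hadj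

end odd2

end RM
/-- For positive integers `r`, `d`, there exists a radially maximal graph of
radius `r` and diameter `d` iff `r ≤ d ≤ 2r - 2`. -/
theorem stmt_3 (r d : ℕ) (hr : 1 ≤ r) (hd : 1 ≤ d) :
    (∃ (n : ℕ) (G : SimpleGraph (Fin n)), RadiallyMaximal G ∧
        graphRadius G = r ∧ graphDiam G = d) ↔
      (r ≤ d ∧ d + 2 ≤ 2 * r) := by
  constructor
  · rintro ⟨n, G, hG, rfl, rfl⟩
    exact RM.forward G hG
  · rintro ⟨h1, h2⟩
    by_cases hrd : d = r
    · subst hrd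
      obtain ⟨a, b, c⟩ := RM.even_case d (by omega)
      obtain ⟨n, H, h3, h4, h5⟩ := RM.transfer _ a
      exact ⟨n, H, h3, h4.trans b, h5.trans c⟩
    · obtain ⟨a, b, c⟩ := RM.odd_case (q := 2 * r - d) (h := d - r) (by omega) (by omega)
      obtain ⟨n, H, h3, h4, h5⟩ := RM.transfer _ a
      exact ⟨n, H, h3, (h4.trans b).trans (by omega), (h5.trans c).trans (by omega)⟩
end

section
/- Let G be a radially maximal graph and let v be a vertex of G that is not an eccentric vertex of any central vertex of G. Then the extension of G at v is radially maximal. -/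
open SimpleGraph

/-- The extension of `G` at `v`: add a new vertex `none` adjacent to `v`
and to every neighbor of `v` in `G`. Old vertices are embedded via `some`. -/
def extensionAt {V : Type*} (G : SimpleGraph V) (v : V) : SimpleGraph (Option V) :=
  SimpleGraph.fromRel (fun x y => match x, y with
    | some a, some b => G.Adj a b
    | some a, none => a = v ∨ G.Adj a v
    | _, _ => False)

theorem aux_rad_le {V : Type*} [Fintype V] (G : SimpleGraph V) (k : ℕ) (c : V)
    (h : ∀ u, G.dist c u ≤ k) : graphRadius G ≤ k := by
  unfold graphRadius
  refine (Nat.sInf_le (Set.mem_range_self c)).trans ?_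
  unfold eccentricity
  exact Finset.sup_le fun u _ => h u

theorem aux_rad_ex {V : Type*} [Fintype V] [Nonempty V] (G : SimpleGraph V) :
    ∃ c, ∀ u, G.dist c u ≤ graphRadius G := by
  obtain ⟨c, hc⟩ := Nat.sInf_mem (Set.range_nonempty (fun v => eccentricity G v))
  refine ⟨c, fun u => ?_⟩
  have h1 : G.dist c u ≤ eccentricity G c :=
    Finset.le_sup (f := fun u => G.dist c u) (Finset.mem_univ u)
  exact h1.trans hc.le

theorem aux_contr {V W : Type*} (H : SimpleGraph W) (K : SimpleGraph V) (hH : H.Connected)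
    (hK : K.Connected) (f : W → V) (hf : ∀ a b, H.Adj a b → f a = f b ∨ K.Adj (f a) (f b))
    (a b : W) : K.dist (f a) (f b) ≤ H.dist a b := by
  obtain ⟨p, hp⟩ := hH.exists_walk_length_eq_dist a b
  rw [← hp]
  clear hp
  induction p with
  | nil => simp
  | @cons a b c h p ih =>
    rw [Walk.length_cons]
    rcases hf _ _ h with h | h
    · rw [h]; omega
    · have := hK.dist_triangle (u := f a) (v := f b) (w := f c)
      rw [dist_eq_one_iff_adj.mpr h] at this
      omega

theorem aux_edge {V : Type*} (G : SimpleGraph V) (hG : G.Connected) (x y : V)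
    (hH : (G ⊔ edge x y).Connected) (c u : V) :
    G.dist c u ≤ (G ⊔ edge x y).dist c u ∨
    G.dist c y + 1 + G.dist x u ≤ (G ⊔ edge x y).dist c u ∨
    G.dist c x + 1 + G.dist y u ≤ (G ⊔ edge x y).dist c u := by
  obtain ⟨p, hp⟩ := hH.exists_walk_length_eq_dist c u
  rw [← hp]
  clear hp
  induction p with
  | nil => simp
  | @cons a b u h p ih =>
    rw [Walk.length_cons]
    rw [sup_adj, edge_adj] at h
    rcases h with h | ⟨⟨rfl, rfl⟩ | ⟨rfl, rfl⟩, _⟩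
    · have h1 := dist_eq_one_iff_adj.mpr h
      have := hG.dist_triangle (u := a) (v := b) (w := u)
      have := hG.dist_triangle (u := a) (v := b) (w := x)
      have := hG.dist_triangle (u := a) (v := b) (w := y)
      omega
    · have : G.dist a a = 0 := dist_self
      have : G.dist b b = 0 := dist_self
      omega
    · have : G.dist a a = 0 := dist_self
      have : G.dist b b = 0 := dist_self
      omega

theorem ext_ss {V : Type*} (G : SimpleGraph V) (v a b : V) :
    (extensionAt G v).Adj (some a) (some b) ↔ G.Adj a b := by
  simp only [extensionAt, fromRel_adj, ne_eq, Option.some.injEq]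
  constructor
  · rintro ⟨_, h | h⟩
    · exact h
    · exact h.symm
  · intro h
    exact ⟨h.ne, Or.inl h⟩

theorem ext_sn {V : Type*} (G : SimpleGraph V) (v a : V) :
    (extensionAt G v).Adj (some a) none ↔ a = v ∨ G.Adj a v := by
  simp [extensionAt, fromRel_adj]

theorem ext_ns {V : Type*} (G : SimpleGraph V) (v a : V) :
    (extensionAt G v).Adj none (some a) ↔ a = v ∨ G.Adj a v := by
  rw [adj_comm, ext_sn]

theorem ext_conn {V : Type*} (G : SimpleGraph V) (v : V) (hG : G.Connected) :
    (extensionAt G v).Connected := by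
  have h : ∀ x, (extensionAt G v).Reachable (some v) x := by
    intro x
    cases x with
    | none => exact ((ext_sn G v v).mpr (Or.inl rfl)).reachable
    | some a =>
      exact (hG.preconnected v a).map (⟨some, fun {a b} h => (ext_ss G v a b).mpr h⟩ : G →g extensionAt G v)
  haveI : Nonempty (Option V) := ⟨none⟩
  exact ⟨fun a b => (h a).symm.trans (h b)⟩

open Classical in
theorem aux_old {V : Type*} [Fintype V] (G : SimpleGraph V) (v : V)
    (hG : RadiallyMaximal G)
    (hv : ∀ c : V, eccentricity G c = graphRadius G → G.dist c v ≠ eccentricity G c)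
    (x y : V) (hxy : x ≠ y) (hadj : ¬ G.Adj x y) (hy : y ≠ v) :
    ∃ c, ∀ u, ((extensionAt G v) ⊔ edge (some x) (some y)).dist c u + 1 ≤ graphRadius G := by
  obtain ⟨hc, hT, hr⟩ := hG
  haveI : Nontrivial V := ⟨x, y, hxy⟩
  have hlt := hr x y hxy hadj
  obtain ⟨c, hcu⟩ := aux_rad_ex (G ⊔ edge x y)
  have hH : (G ⊔ edge x y).Connected := hc.mono le_sup_left
  have hE := ext_conn G v hc
  have hE' : (extensionAt G v ⊔ edge (some x) (some y)).Connected := hE.mono le_sup_left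
  have hnv : (extensionAt G v ⊔ edge (some x) (some y)).dist (some v) none = 1 := by
    rw [dist_eq_one_iff_adj, sup_adj]
    exact Or.inl ((ext_sn G v v).mpr (Or.inl rfl))
  have hsome : ∀ a b, (extensionAt G v ⊔ edge (some x) (some y)).dist (some a) (some b)
      ≤ (G ⊔ edge x y).dist a b := by
    intro a b
    refine aux_contr _ _ hH hE' some (fun a b h => Or.inr ?_) a b
    simp only [sup_adj, ext_ss, edge_adj, Option.some.injEq, ne_eq] at h ⊢
    exact h
  refine ⟨some c, fun u => ?_⟩
  cases u with
  | some u => have := hsome c u; have := hcu u; omega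
  | none =>
  by_cases hcv : c = v
  · subst hcv
    obtain ⟨w, hw⟩ := exists_ne c
    have := hH.pos_dist_of_ne hw.symm
    have := hcu w
    omega
  by_cases hx : x = v
  · subst hx
    have htri := hE'.dist_triangle (u := some c) (v := some x) (w := none)
    have h1 := hsome c x
    have h2 := hcu x
    by_contra hcon
    have hGd : (extensionAt G x ⊔ edge (some x) (some y)).dist (some c) none ≤ G.dist c x := by
      have := aux_contr G (extensionAt G x ⊔ edge (some x) (some y)) hc hE'
        (fun u => if u = x then none else some u) (fun a b h => Or.inr ?_) c x
      · simpa [hcv] using this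
      · rw [sup_adj]
        left
        by_cases ha : a = x
        · have hb : b ≠ x := by rintro rfl; exact h.ne ha
          subst ha
          simp [hb, ext_ns, h.symm]
        · by_cases hb : b = x
          · subst hb
            simp [ha, ext_sn, h]
          · simp [ha, hb, ext_ss, h]
    have hyx : (G ⊔ edge x y).dist y x = 1 := by
      rw [dist_eq_one_iff_adj, sup_adj, edge_adj]
      exact Or.inr ⟨Or.inr ⟨rfl, rfl⟩, hy⟩
    have h3 := hH.dist_triangle (u := c) (v := y) (w := x)
    have h4 : (G ⊔ edge x y).dist c y ≤ G.dist c y :=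
      aux_contr G _ hc hH id (fun a b h => Or.inr (Or.inl h)) c y
    have key : ∀ w, w ≠ x → G.dist c w + 1 ≤ graphRadius G := by
      intro w hw
      have h5 := hcu w
      have h6 := hc.pos_dist_of_ne hw.symm
      rcases aux_edge G hc x y hH c w with h | h | h <;> omega
    obtain ⟨w, hw⟩ := hc.preconnected.exists_adj_of_nontrivial x
    have h7 := key w hw.ne'
    have h8 := hc.dist_triangle (u := c) (v := w) (w := x)
    rw [dist_eq_one_iff_adj.mpr hw.symm] at h8
    have h9 : eccentricity G c = graphRadius G := by
      apply le_antisymm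
      · refine Finset.sup_le fun u _ => ?_
        by_cases hu : u = x
        · subst hu; omega
        · have := key u hu; omega
      · exact Nat.sInf_le (Set.mem_range_self c)
    exact hv c h9 (by omega)
  · have := aux_contr (G ⊔ edge x y) (extensionAt G v ⊔ edge (some x) (some y)) hH hE'
        (fun u => if u = v then none else some u) (fun a b h => Or.inr ?_) c v
    · simp only [hcv, if_true, if_false] at this
      have := hcu v
      omega
    · rw [sup_adj] at h ⊢
      rcases h with h | h
      · left
        by_cases ha : a = v
        · have hb : b ≠ v := by rintro rfl; exact h.ne ha
          subst ha
          simp [hb, ext_ns, h.symm]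
        · by_cases hb : b = v
          · subst hb
            simp [ha, ext_sn, h]
          · simp [ha, hb, ext_ss, h]
      · right
        rw [edge_adj] at h
        rcases h with ⟨⟨rfl, rfl⟩ | ⟨rfl, rfl⟩, _⟩ <;> simp [hx, hy, edge_adj, hxy, hxy.symm]

theorem aux_old' {V : Type*} [Fintype V] (G : SimpleGraph V) (v : V)
    (hG : RadiallyMaximal G)
    (hv : ∀ c : V, eccentricity G c = graphRadius G → G.dist c v ≠ eccentricity G c)
    (x y : V) (hxy : x ≠ y) (hadj : ¬ G.Adj x y) :
    ∃ c, ∀ u, ((extensionAt G v) ⊔ edge (some x) (some y)).dist c u + 1 ≤ graphRadius G := by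
  by_cases hy : y = v
  · rw [edge_comm]
    exact aux_old G v hG hv y x hxy.symm (fun h => hadj h.symm) (fun h => hxy (h.trans hy.symm))
  · exact aux_old G v hG hv x y hxy hadj hy

open Classical in
theorem aux_new {V : Type*} [Fintype V] (G : SimpleGraph V) (v : V)
    (hG : RadiallyMaximal G)
    (hv : ∀ c : V, eccentricity G c = graphRadius G → G.dist c v ≠ eccentricity G c)
    (y : V) (hadj : ¬ (extensionAt G v).Adj none (some y)) :
    ∃ c, ∀ u, ((extensionAt G v) ⊔ edge none (some y)).dist c u + 1 ≤ graphRadius G := by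
  rw [ext_ns, not_or] at hadj
  obtain ⟨hy, hadj⟩ := hadj
  obtain ⟨c, hcu⟩ := aux_old G v hG hv v y (Ne.symm hy) (fun h => hadj h.symm) hy
  have hE := ext_conn G v hG.1
  have key := aux_contr (extensionAt G v ⊔ edge (some v) (some y))
    (extensionAt G v ⊔ edge none (some y)) (hE.mono le_sup_left) (hE.mono le_sup_left)
    (Equiv.swap none (some v)) (fun a b h => Or.inr ?_)
  · refine ⟨Equiv.swap none (some v) c, fun u => ?_⟩
    have h1 := key c (Equiv.swap none (some v) u)
    rw [Equiv.swap_apply_self] at h1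
    have := hcu (Equiv.swap none (some v) u)
    omega
  · have hs : ∀ a, a ≠ v → Equiv.swap none (some v) (some a) = some a := fun a ha =>
      Equiv.swap_apply_of_ne_of_ne (by simp) (by simpa using ha)
    rw [sup_adj] at h ⊢
    rcases h with h | h
    · left
      rcases a with _ | a <;> rcases b with _ | b
      · exact absurd rfl h.ne
      · rw [ext_ns] at h
        by_cases hb : b = v
        · subst hb
          simp [ext_sn]
        · rw [hs b hb, Equiv.swap_apply_left, ext_ss]
          exact (h.resolve_left hb).symm
      · rw [ext_sn] at h
        by_cases hb : a = v
        · subst hb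
          simp [ext_ns]
        · rw [hs a hb, Equiv.swap_apply_left, ext_ss]
          exact (h.resolve_left hb)
      · rw [ext_ss] at h
        by_cases ha : a = v
        · subst ha
          rw [hs b h.ne', Equiv.swap_apply_right, ext_ns]
          exact Or.inr h.symm
        · by_cases hb : b = v
          · subst hb
            rw [hs a ha, Equiv.swap_apply_right, ext_sn]
            exact Or.inr h
          · rw [hs a ha, hs b hb, ext_ss]
            exact h
    · right
      rw [edge_adj] at h
      rcases h with ⟨⟨rfl, rfl⟩ | ⟨rfl, rfl⟩, _⟩ <;>
        rw [hs y hy, Equiv.swap_apply_right, edge_adj] <;> simp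

theorem stmt_4 {V : Type*} [Fintype V] (G : SimpleGraph V) (v : V)
    (hG : RadiallyMaximal G)
    (hv : ∀ c : V, eccentricity G c = graphRadius G → G.dist c v ≠ eccentricity G c) :
    RadiallyMaximal (extensionAt G v) := by
  have hE := ext_conn G v hG.1
  have hrad : graphRadius G ≤ graphRadius (extensionAt G v) := by
    obtain ⟨c, hc⟩ := aux_rad_ex (extensionAt G v)
    have key := aux_contr (extensionAt G v) G hE hG.1 (fun x => x.getD v) (fun a b h => ?_)
    · refine aux_rad_le G _ (c.getD v) fun u => ?_
      exact (key c (some u)).trans (hc (some u))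
    · rcases a with _ | a <;> rcases b with _ | b
      · exact Or.inl rfl
      · rw [ext_ns] at h
        exact h.imp (fun h => h.symm) (fun h => h.symm)
      · rw [ext_sn] at h
        exact h
      · rw [ext_ss] at h
        exact Or.inr h
  refine ⟨hE, ?_, ?_⟩
  · intro h
    apply hG.2.1
    ext a b
    rw [← ext_ss G v a b, h]
    simp
  · intro a b hab hadj
    suffices h : ∃ c, ∀ u, (extensionAt G v ⊔ edge a b).dist c u + 1 ≤ graphRadius G by
      obtain ⟨c, hc⟩ := h
      have h0 := hc c
      have := aux_rad_le (extensionAt G v ⊔ edge a b) (graphRadius G - 1) c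
        (fun u => by have := hc u; omega)
      omega
    rcases a with _ | a <;> rcases b with _ | b
    · exact absurd rfl hab
    · exact aux_new G v hG hv b hadj
    · rw [edge_comm]
      exact aux_new G v hG hv a (fun h => hadj h.symm)
    · exact aux_old' G v hG hv a b (fun h => hab (by rw [h])) (fun h => hadj ((ext_ss G v a b).mpr h))
end

section
/- Every radially maximal graph that is not self-centered has radius at least 3. -/
open SimpleGraph

theorem aux_star {V : Type*} (G : SimpleGraph V) (hc : G.Connected) (x y w : V)
    (h3 : 3 ≤ G.dist x y) (hw : ∀ z, z ≠ w → (G ⊔ SimpleGraph.edge x y).Adj w z) : False := by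
  have hxy : x ≠ y := by
    rintro rfl
    simp at h3
  have hcom : ∀ z, G.Adj x z → G.Adj z y → False := by
    intro z h1 h2
    have := SimpleGraph.dist_le (SimpleGraph.Walk.cons h1 (SimpleGraph.Walk.cons h2 SimpleGraph.Walk.nil))
    simp at this
    omega
  have hna : ¬ G.Adj x y := by
    intro h
    have := SimpleGraph.dist_eq_one_iff_adj.2 h
    omega
  haveI : Nontrivial V := ⟨x, y, hxy⟩
  obtain ⟨a, ha⟩ := hc.preconnected.exists_adj_of_nontrivial x
  obtain ⟨b, hb⟩ := hc.preconnected.exists_adj_of_nontrivial y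
  have hw' : ∀ z, z ≠ w → G.Adj w z ∨ (w = x ∧ z = y) ∨ (w = y ∧ z = x) := by
    intro z hz
    have := hw z hz
    rw [SimpleGraph.sup_adj, SimpleGraph.edge_adj] at this
    tauto
  have hs := fun u v => G.adj_comm u v
  by_cases h1 : w = x
  · subst h1
    have hbn : b ≠ w := by
      rintro rfl
      exact hna hb.symm
    have hby := hb.ne'
    have := hw' b hbn
    exact hcom b (by tauto) hb.symm
  by_cases h2 : w = y
  · subst h2
    have han : a ≠ w := by
      rintro rfl
      exact hna ha
    have hax := ha.ne'
    have := hw' a han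
    have h5 : G.Adj w a := by tauto
    exact hcom a ha h5.symm
  have e1 := hw' x (Ne.symm h1)
  have e2 := hw' y (Ne.symm h2)
  have e3 : G.Adj w x := by tauto
  exact hcom w e3.symm (by tauto)

theorem aux_center {V : Type*} [Fintype V] [Nonempty V] (G : SimpleGraph V) :
    ∃ w, ∀ z, G.dist w z ≤ graphRadius G := by
  obtain ⟨w, hw⟩ := exists_eq_ciInf_of_finite (f := fun v => eccentricity G v)
  refine ⟨w, fun z => ?_⟩
  unfold graphRadius
  rw [← hw]
  exact Finset.le_sup (f := fun u => G.dist w u) (Finset.mem_univ z)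

/-- Every radially maximal graph that is not self-centered has radius at least 3. -/
theorem stmt_8 {V : Type*} [Fintype V] (G : SimpleGraph V)
    (hG : RadiallyMaximal G) (hns : graphRadius G ≠ graphDiam G) :
    3 ≤ graphRadius G := by
  obtain ⟨hc, hne, hmax⟩ := hG
  by_contra hlt
  haveI : Nonempty V := hc.nonempty
  obtain ⟨u, v, huv, hadj⟩ : ∃ u v, u ≠ v ∧ ¬ G.Adj u v := by
    by_contra hcon
    push Not at hcon
    apply hne
    ext a b
    rw [SimpleGraph.top_adj]
    exact ⟨fun h => h.ne, hcon a b⟩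
  haveI : Nontrivial V := ⟨u, v, huv⟩
  have hconn : ∀ a b, (G ⊔ SimpleGraph.edge a b).Connected := fun a b => hc.mono le_sup_left
  have h2 : graphRadius G = 2 := by
    obtain ⟨w, hw⟩ := aux_center (G ⊔ SimpleGraph.edge u v)
    obtain ⟨z, hz⟩ := exists_ne w
    have h1 := (hconn u v).pos_dist_of_ne hz.symm
    have h3 := hw z
    have h4 := hmax u v huv hadj
    omega
  obtain ⟨x, y, hxy⟩ : ∃ x y, 3 ≤ G.dist x y := by
    by_contra hcon
    push Not at hcon
    have hd : graphDiam G ≤ 2 := by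
      refine Finset.sup_le fun a _ => Finset.sup_le fun b _ => ?_
      have := hcon a b
      omega
    have hr : graphRadius G ≤ graphDiam G :=
      (ciInf_le (OrderBot.bddBelow _) u).trans
        (Finset.le_sup (f := fun v => eccentricity G v) (Finset.mem_univ u))
    omega
  have hne' : x ≠ y := by
    rintro rfl
    simp at hxy
  have hna : ¬ G.Adj x y := by
    intro h
    have := SimpleGraph.dist_eq_one_iff_adj.2 h
    omega
  obtain ⟨w, hw⟩ := aux_center (G ⊔ SimpleGraph.edge x y)
  refine aux_star G hc x y w hxy fun z hz => ?_
  have h1 := (hconn x y).pos_dist_of_ne hz.symm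
  have h3 := hw z
  have h4 := hmax x y hne' hna
  exact SimpleGraph.dist_eq_one_iff_adj.1 (by omega)
end

section
/- Let r and d be integers with r < d ≤ 2r - 2, and let H = H(r,d,3r-1) be the graph with vertex set {x_1, ..., x_{2r-1}} ∪ {y_1, ..., y_r} and edge set consisting of the cycle edges x_i x_{i+1} for i = 1, ..., 2r-1 (indices modulo 2r-1, so x_{2r} = x_1), the edge x_{2r-1} y_1, the edges x_{2r-2j+2} y_j for j = 1, ..., 2r-d, the edge x_{d-r+1} y_{2r-d+1}, and the path edges y_t y_{t+1} for t = 2r-d+1, ..., r-1 (present when d ≥ r+2). Then H has radius r, diameter d and order 3r - 1. -/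
open SimpleGraph

/-- The graph `H(r,d,3r-1)` of the paper. Vertex `x_i` (for `i = 1, …, 2r-1`)
is `Sum.inl ⟨i-1⟩` and vertex `y_j` (for `j = 1, …, r`) is `Sum.inr ⟨j-1⟩`.
Edges: the cycle `x_i x_{i+1}` (indices mod `2r-1`, so `x_{2r} = x_1`), the
edge `x_{2r-1} y_1`, the edges `x_{2r-2j+2} y_j` for `j = 1, …, 2r-d`, the edge
`x_{d-r+1} y_{2r-d+1}`, and the path edges `y_t y_{t+1}` for
`t = 2r-d+1, …, r-1`. -/
def paperH (r d : ℕ) : SimpleGraph (Fin (2 * r - 1) ⊕ Fin r) :=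
  SimpleGraph.fromRel (fun u w => match u, w with
    | Sum.inl a, Sum.inl b => b.val = (a.val + 1) % (2 * r - 1)
    | Sum.inl a, Sum.inr b =>
        (a.val = 2 * r - 2 ∧ b.val = 0) ∨
        (b.val + 1 ≤ 2 * r - d ∧ a.val = (2 * r - 2 * (b.val + 1) + 1) % (2 * r - 1)) ∨
        (a.val = d - r ∧ b.val = 2 * r - d)
    | Sum.inr a, Sum.inr b => 2 * r - d ≤ a.val ∧ a.val + 2 ≤ r ∧ b.val = a.val + 1
    | Sum.inr _, Sum.inl _ => False)

/-- cyclic distance -/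
def hCyc (N a b : ℕ) : ℤ := min (max (a : ℤ) b - min (a : ℤ) b) (N - (max (a : ℤ) b - min (a : ℤ) b))

/-- potential function -/
def hPot (r d i : ℕ) (s : ℤ) : Fin (2 * r - 1) ⊕ Fin r → ℤ
  | Sum.inl a => hCyc (2 * r - 1) i a.val
  | Sum.inr b =>
      if b.val = 0 then min (hCyc (2 * r - 1) i 0) (hCyc (2 * r - 1) i (2 * r - 2)) + 1
      else if b.val + 1 ≤ 2 * r - d then hCyc (2 * r - 1) i (2 * r - 2 * b.val - 1) + 1
      else hCyc (2 * r - 1) i (d - r) + s * ((b.val : ℤ) - (2 * r - d) + 1)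

lemma h_mod1 {a N : ℕ} (h : a < N) : (a + 1) % N = if a + 1 = N then 0 else a + 1 := by
  split_ifs with h1
  · rw [h1, Nat.mod_self]
  · exact Nat.mod_eq_of_lt (by omega)

lemma h_mod2 {r b : ℕ} (h : b < r) (hr : 2 ≤ r) : (2 * r - 2 * (b + 1) + 1) % (2 * r - 1)
    = if b = 0 then 0 else 2 * r - 2 * b - 1 := by
  split_ifs with h1
  · subst h1
    have : 2 * r - 2 * (0 + 1) + 1 = 2 * r - 1 := by omega
    rw [this, Nat.mod_self]
  · rw [Nat.mod_eq_of_lt (by omega)]; omega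

lemma h_adj (r d : ℕ) (hrd : r < d) (hd : d + 2 ≤ 2 * r) (i : ℕ) (hi : i < 2 * r - 1) (s : ℤ)
    (hs : s = 1 ∨ s = -1) (u v : Fin (2 * r - 1) ⊕ Fin r) (h : (paperH r d).Adj u v) :
    hPot r d i s v ≤ hPot r d i s u + 1 := by
  rw [paperH, SimpleGraph.fromRel_adj] at h
  obtain ⟨-, h⟩ := h
  rcases u with a | a <;> rcases v with b | b <;> have ha := a.isLt <;> have hb := b.isLt
  · simp only [h_mod1 ha, h_mod1 hb] at h
    simp only [hPot, hCyc]
    split_ifs at h <;> omega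
  · simp only [h_mod2 hb (by omega : 2 ≤ r), or_false] at h
    simp only [hPot]
    rcases h with ⟨h1, h2⟩ | ⟨h1, h2⟩ | ⟨h1, h2⟩
    · rw [if_pos h2, h1]; simp only [hCyc]; omega
    · by_cases h0 : b.val = 0
      · rw [if_pos h0] at h2 ⊢
        rw [h2]; simp only [hCyc]; omega
      · rw [if_neg h0] at h2
        rw [if_neg h0, if_pos h1, h2]
    · rw [if_neg (by omega), if_neg (by omega), h1]
      rcases hs with rfl | rfl <;> omega
  · simp only [h_mod2 ha (by omega : 2 ≤ r), false_or] at h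
    simp only [hPot]
    rcases h with ⟨h1, h2⟩ | ⟨h1, h2⟩ | ⟨h1, h2⟩
    · rw [if_pos h2, h1]; simp only [hCyc]; omega
    · by_cases h0 : a.val = 0
      · rw [if_pos h0] at h2 ⊢
        rw [h2]; simp only [hCyc]; omega
      · rw [if_neg h0] at h2
        rw [if_neg h0, if_pos h1, h2]; linarith
    · rw [if_neg (by omega), if_neg (by omega), h1]
      rcases hs with rfl | rfl <;> omega
  · simp only [hPot]
    rw [if_neg (by omega), if_neg (by omega), if_neg (by omega), if_neg (by omega)]
    rcases hs with rfl | rfl <;> omega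

/-- a short walk exists -/
def hR {V : Type*} (G : SimpleGraph V) (k : ℕ) (u v : V) : Prop := ∃ w : G.Walk u v, w.length ≤ k

section
variable {V : Type*} {G : SimpleGraph V}

lemma hR.rfl' {u : V} : hR G 0 u u := ⟨SimpleGraph.Walk.nil, by simp⟩
lemma hR.of_adj {u v : V} (h : G.Adj u v) : hR G 1 u v := ⟨h.toWalk, by simp⟩
lemma hR.symm {u v : V} {k : ℕ} (h : hR G k u v) : hR G k v u := by
  obtain ⟨w, h⟩ := h
  exact ⟨w.reverse, by simpa using h⟩
lemma hR.trans {u v w : V} {k l : ℕ} (h : hR G k u v) (h' : hR G l v w) : hR G (k + l) u w := by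
  obtain ⟨p, h⟩ := h
  obtain ⟨q, h'⟩ := h'
  exact ⟨p.append q, by rw [SimpleGraph.Walk.length_append]; omega⟩
lemma hR.mono {u v : V} {k l : ℕ} (h : hR G k u v) (hl : k ≤ l) : hR G l u v := by
  obtain ⟨p, h⟩ := h
  exact ⟨p, h.trans hl⟩
lemma hR.dist {u v : V} {k : ℕ} (h : hR G k u v) : G.dist u v ≤ k := by
  obtain ⟨p, h⟩ := h
  exact (SimpleGraph.dist_le p).trans h

lemma h_pot_walk (f : V → ℤ) (hf : ∀ u v, G.Adj u v → f v ≤ f u + 1) {u v : V} (w : G.Walk u v) :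
    f v ≤ f u + w.length := by
  induction w with
  | nil => simp
  | cons h p ih =>
    have := hf _ _ h
    rw [SimpleGraph.Walk.length_cons]
    push_cast
    linarith

lemma h_pot (f : V → ℤ) (hf : ∀ u v, G.Adj u v → f v ≤ f u + 1) {u v : V} {k : ℕ}
    (h : hR G k u v) : f v - f u ≤ G.dist u v := by
  obtain ⟨p, -⟩ := h
  obtain ⟨q, hq⟩ := (SimpleGraph.Walk.reachable p).exists_walk_length_eq_dist
  have := h_pot_walk f hf q
  rw [hq] at this
  linarith
end

section
variable (r d : ℕ)

/-- cycle vertex -/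
def hx (r i : ℕ) (h : i < 2 * r - 1) : Fin (2 * r - 1) ⊕ Fin r := Sum.inl ⟨i, h⟩
/-- other vertex -/
def hy (r j : ℕ) (h : j < r) : Fin (2 * r - 1) ⊕ Fin r := Sum.inr ⟨j, h⟩

lemma h_seg (hd : d + 2 ≤ 2 * r) (a k : ℕ) (h : a + k < 2 * r - 1) :
    hR (paperH r d) k (hx r a (by omega)) (hx r (a + k) h) := by
  induction k with
  | zero => exact hR.rfl'
  | succ k ih =>
    refine (ih (by omega)).trans (hR.of_adj ?_)
    rw [paperH, SimpleGraph.fromRel_adj]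
    refine ⟨by simp [hx], Or.inl ?_⟩
    simp only [hx]
    rw [Nat.mod_eq_of_lt (by omega)]
    omega

lemma h_wrap (hrd : r < d) (hd : d + 2 ≤ 2 * r) :
    hR (paperH r d) 1 (hx r (2 * r - 2) (by omega)) (hx r 0 (by omega)) := by
  refine hR.of_adj ?_
  rw [paperH, SimpleGraph.fromRel_adj]
  refine ⟨by simp [hx]; omega, Or.inl ?_⟩
  simp only [hx]
  rw [show 2 * r - 2 + 1 = 2 * r - 1 by omega, Nat.mod_self]

lemma h_cyc_le (hrd : r < d) (hd : d + 2 ≤ 2 * r) (a b k : ℕ) (ha : a < 2 * r - 1)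
    (hb : b < 2 * r - 1) (hab : a ≤ b) (hk : hCyc (2 * r - 1) a b ≤ k) :
    hR (paperH r d) k (hx r a ha) (hx r b hb) := by
  by_cases h : b - a ≤ k
  · obtain ⟨t, rfl⟩ := Nat.exists_eq_add_of_le hab
    exact (h_seg r d hd a t hb).mono (by omega)
  · have h1 := h_seg r d hd 0 a (by omega)
    have h2 := h_seg r d hd b (2 * r - 2 - b) (by omega)
    have e1 : hx r (0 + a) (by omega) = hx r a ha := by simp [hx]
    have e2 : hx r (b + (2 * r - 2 - b)) (by omega) = hx r (2 * r - 2) (by omega) := by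
      simp only [hx]; congr; omega
    rw [e1] at h1
    rw [e2] at h2
    refine ((h2.trans ((h_wrap r d hrd hd).trans h1)).symm).mono ?_
    simp only [hCyc] at hk
    omega

lemma h_cyc (hrd : r < d) (hd : d + 2 ≤ 2 * r) (a b k : ℕ) (ha : a < 2 * r - 1)
    (hb : b < 2 * r - 1) (hk : hCyc (2 * r - 1) a b ≤ k) :
    hR (paperH r d) k (hx r a ha) (hx r b hb) := by
  rcases le_total a b with h | h
  · exact h_cyc_le r d hrd hd a b k ha hb h hk
  · refine (h_cyc_le r d hrd hd b a k hb ha h ?_).symm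
    simp only [hCyc] at hk ⊢
    omega

lemma h_leaf0 (hrd : r < d) (hd : d + 2 ≤ 2 * r) :
    hR (paperH r d) 1 (hx r 0 (by omega)) (hy r 0 (by omega)) := by
  refine hR.of_adj ?_
  rw [paperH, SimpleGraph.fromRel_adj]
  refine ⟨by simp [hx, hy], Or.inl ?_⟩
  simp only [hx, hy]
  rw [h_mod2 (by omega) (by omega)]
  simp
  omega

lemma h_leaf (hrd : r < d) (hd : d + 2 ≤ 2 * r) (j : ℕ) (h0 : j ≠ 0) (hj : j + 1 ≤ 2 * r - d) :
    hR (paperH r d) 1 (hx r (2 * r - 2 * j - 1) (by omega)) (hy r j (by omega)) := by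
  refine hR.of_adj ?_
  rw [paperH, SimpleGraph.fromRel_adj]
  refine ⟨by simp [hx, hy], Or.inl ?_⟩
  simp only [hx, hy]
  rw [h_mod2 (by omega) (by omega), if_neg h0]
  omega

lemma h_path (hrd : r < d) (hd : d + 2 ≤ 2 * r) (k : ℕ) (hj : 2 * r - d + k < r) :
    hR (paperH r d) (k + 1) (hx r (d - r) (by omega)) (hy r (2 * r - d + k) hj) := by
  induction k with
  | zero =>
    refine hR.of_adj ?_
    rw [paperH, SimpleGraph.fromRel_adj]
    refine ⟨by simp [hx, hy], Or.inl ?_⟩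
    exact Or.inr (Or.inr ⟨rfl, rfl⟩)
  | succ k ih =>
    refine (ih (by omega)).trans (hR.of_adj ?_)
    rw [paperH, SimpleGraph.fromRel_adj]
    refine ⟨by simp [hy], Or.inl ?_⟩
    simp only [hy]
    omega

lemma h_anchor (hrd : r < d) (hd : d + 2 ≤ 2 * r) (v : Fin (2 * r - 1) ⊕ Fin r) :
    ∃ (a : ℕ) (ha : a < 2 * r - 1) (k : ℕ), hR (paperH r d) k (hx r a ha) v ∧
      (k ≤ 1 ∨ (a = d - r ∧ k ≤ d - r)) := by
  rcases v with a | b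
  · exact ⟨a.val, a.isLt, 0, hR.rfl', by omega⟩
  · have hb := b.isLt
    by_cases h0 : b.val = 0
    · have := h_leaf0 r d hrd hd
      have e : hy r 0 (by omega) = Sum.inr b := by
        exact congrArg Sum.inr (Fin.ext h0.symm)
      rw [e] at this
      exact ⟨_, _, _, this, Or.inl le_rfl⟩
    · by_cases h1 : b.val + 1 ≤ 2 * r - d
      · exact ⟨_, _, _, h_leaf r d hrd hd b.val h0 h1, Or.inl le_rfl⟩
      · have := h_path r d hrd hd (b.val - (2 * r - d)) (by omega)
        have e : hy r (2 * r - d + (b.val - (2 * r - d))) (by omega) = Sum.inr b := by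
          simp only [hy]; congr; omega
        rw [e] at this
        exact ⟨_, _, _, this, Or.inr ⟨rfl, by omega⟩⟩

lemma h_diam (hrd : r < d) (hd : d + 2 ≤ 2 * r) (u v : Fin (2 * r - 1) ⊕ Fin r) :
    hR (paperH r d) d u v := by
  obtain ⟨a, ha, k, hk, hk'⟩ := h_anchor r d hrd hd u
  obtain ⟨b, hb, l, hl, hl'⟩ := h_anchor r d hrd hd v
  by_cases h : (2 ≤ k ∧ 2 ≤ l)
  · obtain ⟨rfl, h1⟩ := hk'.resolve_left (by omega)
    obtain ⟨rfl, h2⟩ := hl'.resolve_left (by omega)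
    exact (hk.symm.trans hl).mono (by omega)
  · exact (hk.symm.trans ((h_cyc r d hrd hd a b (r - 1) ha hb (by simp only [hCyc]; omega)).trans hl)).mono
      (by omega)

lemma h_center (hrd : r < d) (hd : d + 2 ≤ 2 * r) (v : Fin (2 * r - 1) ⊕ Fin r) :
    hR (paperH r d) r (hx r (r - 1) (by omega)) v := by
  obtain ⟨b, hb, l, hl, hl'⟩ := h_anchor r d hrd hd v
  rcases hl' with h | ⟨rfl, h⟩
  · exact ((h_cyc r d hrd hd (r-1) b (r - 1) _ hb (by simp only [hCyc]; omega)).trans hl).mono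
      (by omega)
  · exact ((h_cyc r d hrd hd (r-1) (d - r) (2 * r - d - 1) _ hb (by simp only [hCyc]; omega)).trans hl).mono
      (by omega)

lemma h_lower (hrd : r < d) (hd : d + 2 ≤ 2 * r) (i : ℕ) (hi : i < 2 * r - 1) 
    (v : Fin (2 * r - 1) ⊕ Fin r) : hPot r d i 1 v ≤ (paperH r d).dist (hx r i hi) v := by
  have := h_pot (hPot r d i 1) (h_adj r d hrd hd i hi 1 (by simp)) (h_diam r d hrd hd (hx r i hi) v)
  have e : hPot r d i 1 (hx r i hi) = 0 := by
    simp only [hPot, hCyc, hx]; omega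
  omega

lemma h_ecc (hrd : r < d) (hd : d + 2 ≤ 2 * r) (v : Fin (2 * r - 1) ⊕ Fin r) :
    ∃ u, r ≤ (paperH r d).dist v u := by
  rcases v with ⟨i, hi⟩ | ⟨b, hb⟩
  · have key : ∃ u, (r : ℤ) ≤ hPot r d i 1 u := by
      have leaf : ∀ p, p % 2 = 1 → 2 * d - 2 * r + 1 ≤ p → p ≤ 2 * r - 3 →
          (r : ℤ) ≤ hCyc (2 * r - 1) i p + 1 → ∃ u, (r : ℤ) ≤ hPot r d i 1 u := by
        intro p h1 h2 h3 h4
        refine ⟨hy r ((2 * r - 1 - p) / 2) (by omega), ?_⟩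
        simp only [hPot, hy]
        rw [if_neg (by omega), if_pos (by omega)]
        rw [show 2 * r - 2 * ((2 * r - 1 - p) / 2) - 1 = p by omega]
        exact h4
      by_cases hA : (2 * r : ℤ) - d ≤ hCyc (2 * r - 1) i (d - r)
      · refine ⟨hy r (r - 1) (by omega), ?_⟩
        simp only [hPot, hy]
        rw [if_neg (by omega), if_neg (by omega)]
        omega
      by_cases hB : i = r - 1
      · refine ⟨hy r 0 (by omega), ?_⟩
        simp only [hPot, hy, hCyc, if_true]
        omega
      simp only [hCyc] at hA leaf
      by_cases hC : i < r
      · rcases Nat.mod_two_eq_zero_or_one (i + r) with h | h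
        · exact leaf (i + r - 1) (by omega) (by omega) (by omega) (by omega)
        · exact leaf (i + r) (by omega) (by omega) (by omega) (by omega)
      · rcases Nat.mod_two_eq_zero_or_one (i - r) with h | h
        · exact leaf (i - r + 1) (by omega) (by omega) (by omega) (by omega)
        · exact leaf (i - r) (by omega) (by omega) (by omega) (by omega)
    obtain ⟨u, hu⟩ := key
    refine ⟨u, ?_⟩
    have := h_lower r d hrd hd i hi u
    simp only [hx] at this
    omega
  · have key : ∃ i, i < 2 * r - 1 ∧ (r : ℤ) ≤ hPot r d i 1 (Sum.inr ⟨b, hb⟩) := by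
      simp only [hPot]
      split_ifs with h1 h2
      · exact ⟨r - 1, by omega, by simp only [hCyc]; omega⟩
      · by_cases h : 2 * r - 2 * b - 1 < r
        · exact ⟨2 * r - 2 * b - 1 + (r - 1), by omega, by simp only [hCyc]; omega⟩
        · exact ⟨2 * r - 2 * b - 1 - (r - 1), by omega, by simp only [hCyc]; omega⟩
      · exact ⟨d - 1, by omega, by simp only [hCyc]; omega⟩
    obtain ⟨i, hi, h⟩ := key
    refine ⟨hx r i hi, ?_⟩
    have := h_lower r d hrd hd i hi (Sum.inr ⟨b, hb⟩)
    rw [SimpleGraph.dist_comm]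
    omega

lemma h_far (hrd : r < d) (hd : d + 2 ≤ 2 * r) :
    ∃ u v, d ≤ (paperH r d).dist u v := by
  have leaf : ∀ p, p % 2 = 1 → 2 * d - 2 * r + 1 ≤ p → p ≤ 2 * r - 3 →
      (r : ℤ) ≤ hCyc (2 * r - 1) (d - r) p + 1 → ∃ u, (r : ℤ) ≤ hPot r d (d - r) (-1) u := by
    intro p h1 h2 h3 h4
    refine ⟨hy r ((2 * r - 1 - p) / 2) (by omega), ?_⟩
    simp only [hPot, hy]
    rw [if_neg (by omega), if_pos (by omega)]
    rw [show 2 * r - 2 * ((2 * r - 1 - p) / 2) - 1 = p by omega]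
    exact h4
  have key : ∃ u, (r : ℤ) ≤ hPot r d (d - r) (-1) u := by
    simp only [hCyc] at leaf
    rcases Nat.mod_two_eq_zero_or_one d with h | h
    · exact leaf (d - 1) (by omega) (by omega) (by omega) (by omega)
    · exact leaf d (by omega) (by omega) (by omega) (by omega)
  obtain ⟨v, hv⟩ := key
  refine ⟨hy r (r - 1) (by omega), v, ?_⟩
  have := h_pot (hPot r d (d - r) (-1)) (h_adj r d hrd hd (d - r) (by omega) (-1) (by simp))
    (h_diam r d hrd hd (hy r (r - 1) (by omega)) v)
  have e : hPot r d (d - r) (-1) (hy r (r - 1) (by omega)) = r - d := by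
    simp only [hPot, hy, hCyc]
    rw [if_neg (by omega), if_neg (by omega)]
    omega
  omega
end

/-- `H(r,d,3r-1)` has radius `r`, diameter `d` and order `3r - 1`. -/
theorem stmt_11 (r d : ℕ) (hrd : r < d) (hd : d + 2 ≤ 2 * r) :
    graphRadius (paperH r d) = r ∧ graphDiam (paperH r d) = d ∧
      Fintype.card (Fin (2 * r - 1) ⊕ Fin r) = 3 * r - 1 := by
  have : Nonempty (Fin (2 * r - 1) ⊕ Fin r) := ⟨hx r 0 (by omega)⟩
  refine ⟨le_antisymm ?_ ?_, le_antisymm ?_ ?_, ?_⟩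
  · unfold graphRadius
    refine (ciInf_le (OrderBot.bddBelow _) (hx r (r - 1) (by omega))).trans ?_
    exact Finset.sup_le fun v _ => (h_center r d hrd hd v).dist
  · unfold graphRadius
    refine le_ciInf fun v => ?_
    obtain ⟨u, hu⟩ := h_ecc r d hrd hd v
    exact hu.trans (Finset.le_sup (f := fun u => (paperH r d).dist v u) (Finset.mem_univ u))
  · exact Finset.sup_le fun u _ => Finset.sup_le fun v _ => (h_diam r d hrd hd u v).dist
  · obtain ⟨u, v, h⟩ := h_far r d hrd hd
    refine h.trans ?_
    refine (Finset.le_sup (f := fun v => (paperH r d).dist u v) (Finset.mem_univ v)).trans ?_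
    exact Finset.le_sup (f := fun u => eccentricity (paperH r d) u) (Finset.mem_univ u)
  · simp only [Fintype.card_sum, Fintype.card_fin]
    omega
end
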